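/- arXiv:1810.01563 — 9 statements merged into one kernel-verified Lean document; each statement's English description precedes it below -/
import Mathlib

section
/- Let m ≥ 1 and let c_1, …, c_m be integers with c_i ≥ 2 for all i. If z_1, …, z_m are integers that are not all zero, then Q_{c_1,…,c_m}(z_1,…,z_m) ≥ 2 + Σ_{i=1}^m (c_i − 2)·|z_i|. -/
theorem aux_T (z : ℕ → ℤ) (n : ℕ) :
    z n ^ 2 ≤ 2 * ((∑ i ∈ Finset.range (n+1), z i ^ 2) - ∑ i ∈ Finset.range n, z i * z (i + 1)) ∧
    ((∃ i < n + 1, z i ≠ 0) →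
    z n ^ 2 + 1 ≤ 2 * ((∑ i ∈ Finset.range (n+1), z i ^ 2)
      - ∑ i ∈ Finset.range n, z i * z (i + 1))) := by
  induction n with
  | zero =>
    refine ⟨?_, ?_⟩
    · simp only [zero_add, Finset.sum_range_one, Finset.sum_range_zero]
      nlinarith [sq_nonneg (z 0)]
    · rintro ⟨i, hi, h⟩
      obtain rfl : i = 0 := by omega
      have : 0 < z 0 ^ 2 := by positivity
      simp only [zero_add, Finset.sum_range_one, Finset.sum_range_zero]
      linarith
  | succ n ih =>
    obtain ⟨h1, h2⟩ := ih
    rw [Finset.sum_range_succ (fun i => z i ^ 2) (n+1),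
      Finset.sum_range_succ (fun i => z i * z (i+1)) n]
    refine ⟨by nlinarith [sq_nonneg (z n - z (n+1))], ?_⟩
    rintro ⟨i, hi, h⟩
    by_cases hE : ∃ i < n + 1, z i ≠ 0
    · have := h2 hE
      nlinarith [sq_nonneg (z n - z (n+1))]
    · push Not at hE
      have h0 : z n = 0 := hE n (by omega)
      have hin : i = n + 1 := by
        by_contra hne
        exact h (hE i (by omega))
      subst hin
      have : 0 < z (n+1) ^ 2 := by positivity
      rw [h0] at h1 ⊢
      linarith

/-- `Q_{c_1,…,c_m}(z_1,…,z_m) ≥ 2 + Σ (c_i − 2)|z_i|` when the `z_i` are not all zero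
and each `c_i ≥ 2`.  Here `c i` and `z i` for `i < m` represent `c_{i+1}` and `z_{i+1}`,
and `Q_{c_1,…,c_m}(z_1,…,z_m) = Σ c_i z_i² − 2 Σ z_i z_{i+1}`. -/
theorem stmt_0 (m : ℕ) (hm : 1 ≤ m) (c z : ℕ → ℤ)
    (hc : ∀ i < m, 2 ≤ c i)
    (hz : ∃ i < m, z i ≠ 0) :
    (∑ i ∈ Finset.range m, c i * z i ^ 2)
      - 2 * ∑ i ∈ Finset.range (m - 1), z i * z (i + 1)
      ≥ 2 + ∑ i ∈ Finset.range m, (c i - 2) * |z i| := by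
  obtain ⟨n, rfl⟩ : ∃ n, m = n + 1 := ⟨m - 1, by omega⟩
  have h := (aux_T z n).2 hz
  have hs : ∑ i ∈ Finset.range (n+1), ((c i - 2) * |z i| + 2 * z i ^ 2) ≤
      ∑ i ∈ Finset.range (n+1), c i * z i ^ 2 := by
    apply Finset.sum_le_sum
    intro i hi
    have h2 := hc i (Finset.mem_range.mp hi)
    have h3 : |z i| ≤ z i ^ 2 := by
      rw [← sq_abs]
      exact Int.le_self_sq _
    nlinarith [mul_le_mul_of_nonneg_left h3 (sub_nonneg.mpr h2)]
  rw [Finset.sum_add_distrib, ← Finset.mul_sum] at hs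
  have := sq_nonneg (z n)
  simp only [Nat.add_sub_cancel]
  omega
end

section
/- Let m ≥ 1 and let c_1, …, c_m be integers with c_i ≥ 2 for all i. Then for all integers c, z_1, …, z_m, Q_{1,c_1,…,c_m}(c,z_1,…,z_m) ≥ |c| + Σ_{i=1}^m (c_i − 2)·|z_i|. -/
theorem abs_le_sq_aux (x : ℤ) : |x| ≤ x ^ 2 := by
  simpa using Int.le_self_sq |x|

theorem aux_Q (c : ℤ) (cs z : ℕ → ℤ) (n : ℕ) (hcs : ∀ i ≤ n, 2 ≤ cs i) :
    |c| - |z n| + ∑ i ∈ Finset.range (n + 1), (cs i - 2) * |z i| ≤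
    c ^ 2 - 2 * c * z 0 + (∑ i ∈ Finset.range (n + 1), cs i * z i ^ 2)
      - 2 * (∑ i ∈ Finset.range n, z i * z (i + 1)) - z n ^ 2 := by
  induction n with
  | zero =>
    have h1 := abs_le_sq_aux (c - z 0)
    have h2 := abs_sub_abs_le_abs_sub c (z 0)
    have h3 := mul_le_mul_of_nonneg_left (abs_le_sq_aux (z 0))
      (sub_nonneg.2 (hcs 0 le_rfl))
    simp only [zero_add, Finset.sum_range_one, Finset.sum_range_zero]
    linarith
  | succ n ih =>
    have ih := ih (fun i hi => hcs i (by omega))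
    have h1 := abs_le_sq_aux (z n - z (n + 1))
    have h2 := abs_sub_abs_le_abs_sub (z n) (z (n + 1))
    have h3 := mul_le_mul_of_nonneg_left (abs_le_sq_aux (z (n + 1)))
      (sub_nonneg.2 (hcs (n + 1) le_rfl))
    rw [Finset.sum_range_succ _ (n + 1), Finset.sum_range_succ _ (n + 1),
      Finset.sum_range_succ (fun i => z i * z (i + 1)) n]
    linarith


/-- `Q_{1,c_1,…,c_m}(c,z_1,…,z_m) ≥ |c| + Σ (c_i − 2)|z_i|` when each `c_i ≥ 2`.
Here `cs i` and `z i` for `i < m` represent `c_{i+1}` and `z_{i+1}`, and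
`Q_{1,c_1,…,c_m}(c,z_1,…,z_m) = c² − 2cz_1 + Σ c_i z_i² − 2 Σ z_i z_{i+1}`. -/
theorem stmt_1 (m : ℕ) (hm : 1 ≤ m) (c : ℤ) (cs z : ℕ → ℤ)
    (hcs : ∀ i < m, 2 ≤ cs i) :
    c ^ 2 - 2 * c * z 0
      + (∑ i ∈ Finset.range m, cs i * z i ^ 2)
      - 2 * ∑ i ∈ Finset.range (m - 1), z i * z (i + 1)
      ≥ |c| + ∑ i ∈ Finset.range m, (cs i - 2) * |z i| := by
  obtain ⟨n, rfl⟩ : ∃ n, m = n + 1 := ⟨m - 1, by omega⟩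
  have h := aux_Q c cs z n (fun i hi => hcs i (by omega))
  have h2 := abs_le_sq_aux (z n)
  simp only [Nat.add_sub_cancel]
  linarith
end

section
/- Let m ≥ 1 and let c_1, …, c_m be integers with c_i ≥ 2 for all i. If c, z_1, …, z_m are integers that are not all zero, then Q_{1,c_1,…,c_m}(c,z_1,…,z_m) + |c| ≥ 2 + Σ_{i=1}^m (c_i − 2)·|z_i|. -/
lemma aux_abs_le_sq (a : ℤ) : |a| ≤ a ^ 2 := by
  rw [← sq_abs a]
  rcases (abs_nonneg a).eq_or_lt with h | h
  · rw [← h]; norm_num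
  · nlinarith

lemma aux_path (c : ℤ) (z : ℕ → ℤ) (n : ℕ) :
    |c - z n| ≤ c ^ 2 - 2 * c * z 0 + 2 * (∑ i ∈ Finset.range (n + 1), z i ^ 2)
        - 2 * (∑ i ∈ Finset.range n, z i * z (i + 1)) - z n ^ 2 ∧
    ∀ j ≤ n, |c - z j| + |z j - z n| ≤
      c ^ 2 - 2 * c * z 0 + 2 * (∑ i ∈ Finset.range (n + 1), z i ^ 2)
        - 2 * (∑ i ∈ Finset.range n, z i * z (i + 1)) - z n ^ 2 := by
  induction n with
  | zero =>
    have h := aux_abs_le_sq (c - z 0)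
    constructor
    · simp; nlinarith
    · intro j hj
      obtain rfl : j = 0 := by omega
      simp; nlinarith
  | succ n ih =>
    obtain ⟨h1, h2⟩ := ih
    have h := aux_abs_le_sq (z n - z (n + 1))
    rw [Finset.sum_range_succ _ (n + 1), Finset.sum_range_succ (fun i => z i * z (i + 1)) n]
    have h3 := abs_sub_le c (z n) (z (n + 1))
    constructor
    · nlinarith
    · intro j hj
      rcases Nat.lt_or_ge n j with hlt | hle
      · obtain rfl : j = n + 1 := by omega
        rw [sub_self, abs_zero]
        nlinarith
      · have h4 := h2 j hle
        have h5 := abs_sub_le (z j) (z n) (z (n + 1))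
        nlinarith

/-- `Q_{1,c_1,…,c_m}(c,z_1,…,z_m) + |c| ≥ 2 + Σ (c_i − 2)|z_i|` when each `c_i ≥ 2`
and `c, z_1, …, z_m` are not all zero.  Here `cs i` and `z i` for `i < m` represent
`c_{i+1}` and `z_{i+1}`, and
`Q_{1,c_1,…,c_m}(c,z_1,…,z_m) = c² − 2cz_1 + Σ c_i z_i² − 2 Σ z_i z_{i+1}`. -/
theorem stmt_2 (m : ℕ) (hm : 1 ≤ m) (c : ℤ) (cs z : ℕ → ℤ)
    (hcs : ∀ i < m, 2 ≤ cs i)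
    (hnz : c ≠ 0 ∨ ∃ i < m, z i ≠ 0) :
    c ^ 2 - 2 * c * z 0
      + (∑ i ∈ Finset.range m, cs i * z i ^ 2)
      - 2 * ∑ i ∈ Finset.range (m - 1), z i * z (i + 1)
      + |c|
      ≥ 2 + ∑ i ∈ Finset.range m, (cs i - 2) * |z i| := by
  obtain ⟨n, rfl⟩ : ∃ n, m = n + 1 := ⟨m - 1, by omega⟩
  rw [Nat.add_sub_cancel]
  have key : 2 * (∑ i ∈ Finset.range (n + 1), z i ^ 2)
      + ∑ i ∈ Finset.range (n + 1), (cs i - 2) * |z i|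
      ≤ ∑ i ∈ Finset.range (n + 1), cs i * z i ^ 2 := by
    rw [Finset.mul_sum, ← Finset.sum_add_distrib]
    apply Finset.sum_le_sum
    intro i hi
    have h1 := hcs i (Finset.mem_range.mp hi)
    have h2 := mul_le_mul_of_nonneg_left (aux_abs_le_sq (z i)) (sub_nonneg.mpr h1)
    linarith
  obtain ⟨h1, h2⟩ := aux_path c z n
  have h3 := aux_abs_le_sq (z n)
  rcases hnz with hc | ⟨j, hj, hz⟩
  · have h4 := Int.one_le_abs hc
    have h5 : |c| ≤ |c - z n| + |z n| := by
      simpa using abs_add_le (c - z n) (z n)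
    linarith
  · have h4 := Int.one_le_abs hz
    have h5 := h2 j (by omega)
    have h6 : |z j| ≤ |z j - z n| + |z n| := by
      simpa using abs_add_le (z j - z n) (z n)
    have h7 : |z j| ≤ |c - z j| + |c| := by
      have := abs_add_le (z j - c) c
      rw [abs_sub_comm (z j) c] at this
      simpa using this
    linarith
end

section
/- Let k, l ≥ 1 and let a_1, …, a_k, b_1, …, b_l be integers all at least 2 such that 1/[a_1,…,a_k]⁻ + 1/[b_1,…,b_l]⁻ < 1. Then for any integers x_1, …, x_k, y_1, …, y_l, c with at least one of them non-zero, Q_{a_k,…,a_1,1,b_1,…,b_l}(x_k,…,x_1,c,y_1,…,y_l) + |c| ≥ 2 + Σ_{i=1}^k (a_i − 2)·|x_i| + Σ_{i=1}^l (b_i − 2)·|y_i|. -/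
/-- The negative continued fraction `[a_0, …, a_{n-1}]⁻ = a_0 − 1/[a_1, …, a_{n-1}]⁻`
(with junk value `1` for the empty list). -/
def negCF : (ℕ → ℤ) → ℕ → ℚ
  | _, 0 => 1
  | a, 1 => a 0
  | a, n + 2 => (a 0 : ℚ) - 1 / negCF (fun i => a (i + 1)) (n + 1)

def HH : ℤ → List (ℤ × ℤ) → ℤ
  | c, [] => c ^ 2
  | c, p :: t => (c - p.2) ^ 2 + (p.1 - 2) * (p.2 ^ 2 - p.2) + HH p.2 t

def rr : List (ℤ × ℤ) → ℚ
  | [] => 0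
  | p :: t => 1 / ((p.1 : ℚ) - rr t)

def mkL : ℕ → (ℕ → ℤ) → (ℕ → ℤ) → List (ℤ × ℤ)
  | 0, _, _ => []
  | n + 1, a, x => (a 0, |x 0|) :: mkL n (fun i => a (i + 1)) (fun i => x (i + 1))

def VV (A : List (ℤ × ℤ)) : Prop := ∀ p ∈ A, 2 ≤ p.1 ∧ 0 ≤ p.2

theorem sq_ge_self (x : ℤ) : x ≤ x ^ 2 := by
  rcases le_or_gt x 0 with h | h <;> nlinarith

theorem VV_cons {p : ℤ × ℤ} {t : List (ℤ × ℤ)} (h : VV (p :: t)) :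
    2 ≤ p.1 ∧ 0 ≤ p.2 ∧ VV t :=
  ⟨(h p (by simp)).1, (h p (by simp)).2, fun q hq => h q (by simp [hq])⟩

theorem HH_ge (A : List (ℤ × ℤ)) : ∀ c : ℤ, VV A → c ≤ HH c A := by
  induction A with
  | nil => intro c _; exact sq_ge_self c
  | cons p t ih =>
    intro c h
    obtain ⟨h1, h2, h3⟩ := VV_cons h
    have := ih p.2 h3
    have h4 := sq_ge_self (c - p.2)
    have h5 : 0 ≤ (p.1 - 2) * (p.2 ^ 2 - p.2) :=
      mul_nonneg (by linarith) (by linarith [sq_ge_self p.2])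
    simp only [HH]; linarith

theorem HH_pos (A : List (ℤ × ℤ)) : ∀ c : ℤ, VV A → (∃ p ∈ A, p.2 ≠ 0) → 0 < HH c A := by
  induction A with
  | nil => intro c _ h; simp at h
  | cons p t ih =>
    intro c h hz
    obtain ⟨h1, h2, h3⟩ := VV_cons h
    have h4 := sq_nonneg (c - p.2)
    have h5 : 0 ≤ (p.1 - 2) * (p.2 ^ 2 - p.2) :=
      mul_nonneg (by linarith) (by linarith [sq_ge_self p.2])
    have h6 : 0 < HH p.2 t := by
      obtain ⟨q, hq, hq0⟩ := hz
      rcases List.mem_cons.1 hq with rfl | hq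
      · have := HH_ge t q.2 h3
        have : 0 < q.2 := lt_of_le_of_ne h2 (Ne.symm hq0)
        linarith
      · exact ih _ h3 ⟨q, hq, hq0⟩
    simp only [HH]; linarith

theorem rr_bd (A : List (ℤ × ℤ)) : VV A → 0 ≤ rr A ∧ rr A < 1 := by
  induction A with
  | nil => intro _; simp [rr]
  | cons p t ih =>
    intro h
    obtain ⟨h1, h2, h3⟩ := VV_cons h
    obtain ⟨i1, i2⟩ := ih h3
    have h1' : (2 : ℚ) ≤ p.1 := by exact_mod_cast h1
    simp only [rr]
    refine ⟨by apply div_nonneg <;> linarith, ?_⟩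
    rw [div_lt_one (by linarith)]; linarith

theorem step (n : ℕ) (ih : ∀ A B : List (ℤ × ℤ), A.length + B.length ≤ n → VV A → VV B →
      rr A + rr B < 1 → ∀ c : ℤ, 0 < c → c ^ 2 - c < HH c A + HH c B)
    (b x y : ℤ) (A B : List (ℤ × ℤ)) (hl : A.length + B.length + 1 ≤ n)
    (hA : VV ((2, x) :: A)) (hB : VV ((b, y) :: B)) (hb : 3 ≤ b)
    (hr : rr ((2, x) :: A) + rr ((b, y) :: B) < 1) (c : ℤ) (hc : 0 < c) :
    c ^ 2 - c < HH c ((2, x) :: A) + HH c ((b, y) :: B) := by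
  obtain ⟨-, hx, hA'⟩ := VV_cons hA
  obtain ⟨-, hy, hB'⟩ := VV_cons hB
  have hBge := HH_ge _ c hB
  have hAge := HH_ge _ x hA'
  simp only at hx hy
  rcases hx.eq_or_lt with h0 | h0
  · subst h0
    simp only [HH] at hBge ⊢
    nlinarith
  have hB2 : VV ((b - 1, y) :: B) := by
    intro p hp
    rcases List.mem_cons.1 hp with rfl | hp
    · exact ⟨by simp only; linarith, hy⟩
    · exact hB' p hp
  have key := ih A ((b - 1, y) :: B) (by simp; omega) hA' hB2 (by
    obtain ⟨a0, a1⟩ := rr_bd A hA'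
    obtain ⟨b0, b1⟩ := rr_bd B hB'
    have hbq : (3 : ℚ) ≤ b := by exact_mod_cast hb
    simp only [rr] at hr ⊢
    push_cast at hr ⊢
    generalize rr A = s at *
    generalize rr B = t at *
    have p1 : 0 < 2 - s := by linarith
    have p2 : 0 < (b : ℚ) - t := by linarith
    have p3 : 0 < (b : ℚ) - 1 - t := by linarith
    rw [div_add_div _ _ p1.ne' p2.ne', div_lt_one (by positivity)] at hr
    have : 1 / ((b : ℚ) - 1 - t) < 1 - s := by
      rw [div_lt_iff₀ p3]; nlinarith
    linarith) x h0
  have e := sq_ge_self (x + y - c)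
  simp only [HH] at key ⊢
  nlinarith

theorem big (A B : List (ℤ × ℤ)) (a x y b : ℤ) (hA : VV ((a, x) :: A)) (hB : VV ((b, y) :: B))
    (ha : 3 ≤ a) (hb : 3 ≤ b) (c : ℤ) (hc : 0 < c) :
    c ^ 2 - c < HH c ((a, x) :: A) + HH c ((b, y) :: B) := by
  have h (A : List (ℤ × ℤ)) (a x : ℤ) (hA : VV ((a, x) :: A)) (ha : 3 ≤ a) :
      c ^ 2 ≤ 2 * HH c ((a, x) :: A) := by
    obtain ⟨-, hx, hA'⟩ := VV_cons hA
    have hAge := HH_ge _ x hA'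
    simp only [HH]
    have := mul_nonneg (sub_nonneg.2 ha) (sub_nonneg.2 (sq_ge_self x))
    nlinarith [sq_nonneg (c - 2 * x)]
  have := h A a x hA ha
  have := h B b y hB hb
  linarith

theorem main_list (n : ℕ) : ∀ A B : List (ℤ × ℤ), A.length + B.length ≤ n → VV A → VV B →
      rr A + rr B < 1 → ∀ c : ℤ, 0 < c → c ^ 2 - c < HH c A + HH c B := by
  induction n with
  | zero =>
    intro A B hl hA hB _ c hc
    have : A = [] := by apply List.eq_nil_of_length_eq_zero; omega
    subst this
    have := HH_ge B c hB
    simp only [HH]; linarith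
  | succ n ih =>
    intro A B hl hA hB hr c hc
    rcases A with _ | ⟨⟨a, x⟩, A⟩
    · have := HH_ge B c hB
      simp only [HH]; linarith
    rcases B with _ | ⟨⟨b, y⟩, B⟩
    · have := HH_ge _ c hA
      simp only [HH] at this ⊢; linarith
    have ha := (VV_cons hA).1
    have hb := (VV_cons hB).1
    simp only at ha hb
    simp only [List.length_cons] at hl
    rcases ha.eq_or_lt with ha | ha <;> rcases hb.eq_or_lt with hb | hb
    · subst ha; subst hb
      exfalso
      have h (A : List (ℤ × ℤ)) (x : ℤ) (hA : VV ((2, x) :: A)) :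
          1 / 2 ≤ rr ((2, x) :: A) := by
        obtain ⟨i1, i2⟩ := rr_bd A (VV_cons hA).2.2
        simp only [rr]
        apply one_div_le_one_div_of_le <;> push_cast <;> linarith
      have := h A x hA
      have := h B y hB
      linarith
    · subst ha
      exact step n ih b x y A B (by omega) hA hB hb hr c hc
    · subst hb
      rw [add_comm] at hr ⊢
      exact step n ih a y x B A (by omega) hB hA ha hr c hc
    · exact big A B a x y b hA hB ha hb c hc

theorem rr_mkL (k : ℕ) : ∀ a x : ℕ → ℤ, rr (mkL (k + 1) a x) = 1 / negCF a (k + 1) := by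
  induction k with
  | zero => intro a x; simp [mkL, rr, negCF]
  | succ k ih =>
    intro a x
    have := ih (fun i => a (i + 1)) (fun i => x (i + 1))
    rw [mkL, rr, this, negCF]

theorem VV_mkL (k : ℕ) : ∀ a x : ℕ → ℤ, (∀ i < k, 2 ≤ a i) → VV (mkL k a x) := by
  induction k with
  | zero => intro a x _ p hp; simp [mkL] at hp
  | succ k ih =>
    intro a x h p hp
    rcases List.mem_cons.1 hp with rfl | hp
    · exact ⟨h 0 (by omega), abs_nonneg _⟩
    · exact ih _ _ (fun i hi => h (i + 1) (by omega)) p hp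

theorem mem_mkL (k : ℕ) : ∀ a x : ℕ → ℤ, (∃ i < k, x i ≠ 0) → ∃ p ∈ mkL k a x, p.2 ≠ 0 := by
  induction k with
  | zero => rintro a x ⟨i, hi, _⟩; omega
  | succ k ih =>
    rintro a x ⟨i, hi, h⟩
    rcases i with _ | i
    · exact ⟨_, List.mem_cons_self, by simpa using h⟩
    · obtain ⟨p, hp, h⟩ := ih (fun i => a (i + 1)) (fun i => x (i + 1)) ⟨i, by omega, h⟩
      exact ⟨p, List.mem_cons_of_mem _ hp, h⟩

theorem bridge (k : ℕ) : ∀ (a x : ℕ → ℤ) (c : ℤ), HH |c| (mkL (k + 1) a x) ≤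
    (∑ i ∈ Finset.range (k + 1), a i * x i ^ 2) - 2 * (∑ i ∈ Finset.range k, x i * x (i + 1))
      - 2 * x 0 * c - (∑ i ∈ Finset.range (k + 1), (a i - 2) * |x i|) + c ^ 2 := by
  induction k with
  | zero =>
    intro a x c
    have h : c * x 0 ≤ |c| * |x 0| := by rw [← abs_mul]; exact le_abs_self _
    have h1 := sq_abs c
    have h2 := sq_abs (x 0)
    simp [mkL, HH]
    nlinarith
  | succ k ih =>
    intro a x c
    have h : c * x 0 ≤ |c| * |x 0| := by rw [← abs_mul]; exact le_abs_self _
    have h1 := sq_abs c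
    have h2 := sq_abs (x 0)
    have := ih (fun i => a (i + 1)) (fun i => x (i + 1)) (x 0)
    rw [Finset.sum_range_succ' (fun i => a i * x i ^ 2) (k + 1),
      Finset.sum_range_succ' (fun i => x i * x (i + 1)) k,
      Finset.sum_range_succ' (fun i => (a i - 2) * |x i|) (k + 1), mkL, HH]
    simp only [zero_add] at this ⊢
    rw [h2]
    nlinarith

theorem par (k : ℕ) (a x : ℕ → ℤ) :
    (2 : ℤ) ∣ ∑ i ∈ Finset.range k, a i * x i ^ 2 - ∑ i ∈ Finset.range k, (a i - 2) * |x i| := by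
  rw [← Finset.sum_sub_distrib]
  apply Finset.dvd_sum
  intro i _
  have h : (2 : ℤ) ∣ |x i| * (|x i| - 1) := by
    have := (Int.even_mul_pred_self |x i|)
    exact this.two_dvd
  rw [show a i * x i ^ 2 - (a i - 2) * |x i| = a i * (|x i| * (|x i| - 1)) + 2 * |x i| by
    rw [← sq_abs (x i)]; ring]
  exact dvd_add (h.mul_left _) (dvd_mul_right _ _)

/-- Key technical inequality:  if `a_1,…,a_k, b_1,…,b_l ≥ 2` satisfy
`1/[a_1,…,a_k]⁻ + 1/[b_1,…,b_l]⁻ < 1`, then for integers `x_1,…,x_k,y_1,…,y_l,c`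
not all zero,
`Q_{a_k,…,a_1,1,b_1,…,b_l}(x_k,…,x_1,c,y_1,…,y_l) + |c|
  ≥ 2 + Σ (a_i − 2)|x_i| + Σ (b_i − 2)|y_i|`.
Here `a i, x i` (for `i < k`) represent `a_{i+1}, x_{i+1}`, similarly for `b, y`, and
the quadratic form is written out explicitly (note that reversing the order of the
`a`-chain leaves its value unchanged):  `x 0` (i.e. `x_1`) is the variable adjacent
to `c` on one side and `y 0` (i.e. `y_1`) on the other. -/
theorem stmt_4 (k l : ℕ) (hk : 1 ≤ k) (hl : 1 ≤ l)
    (a b : ℕ → ℤ) (ha : ∀ i < k, 2 ≤ a i) (hb : ∀ i < l, 2 ≤ b i)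
    (hcf : 1 / negCF a k + 1 / negCF b l < 1)
    (x y : ℕ → ℤ) (c : ℤ)
    (hnz : c ≠ 0 ∨ (∃ i < k, x i ≠ 0) ∨ (∃ i < l, y i ≠ 0)) :
    (∑ i ∈ Finset.range k, a i * x i ^ 2) + c ^ 2 + (∑ i ∈ Finset.range l, b i * y i ^ 2)
      - 2 * (∑ i ∈ Finset.range (k - 1), x i * x (i + 1))
      - 2 * x 0 * c - 2 * c * y 0
      - 2 * (∑ i ∈ Finset.range (l - 1), y i * y (i + 1))
      + |c|
      ≥ 2 + (∑ i ∈ Finset.range k, (a i - 2) * |x i|)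
          + (∑ i ∈ Finset.range l, (b i - 2) * |y i|) := by
  obtain ⟨k, rfl⟩ : ∃ m, k = m + 1 := ⟨k - 1, by omega⟩
  obtain ⟨l, rfl⟩ : ∃ m, l = m + 1 := ⟨l - 1, by omega⟩
  have vA := VV_mkL _ a x ha
  have vB := VV_mkL _ b y hb
  rw [← rr_mkL k a x, ← rr_mkL l b y] at hcf
  have bA := bridge k a x c
  have bB := bridge l b y c
  have pA := par (k + 1) a x
  have pB := par (l + 1) b y
  have pc : (2 : ℤ) ∣ c ^ 2 + |c| := by
    have := (Int.even_mul_succ_self |c|).two_dvd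
    rwa [show |c| * (|c| + 1) = c ^ 2 + |c| by rw [← sq_abs c]; ring] at this
  have hpos : 0 < HH |c| (mkL (k + 1) a x) + HH |c| (mkL (l + 1) b y) - c ^ 2 + |c| := by
    by_cases hc : c = 0
    · subst hc
      have gA := HH_ge _ 0 vA
      have gB := HH_ge _ 0 vB
      simp only [abs_zero]
      rcases hnz with h | h | h
      · exact absurd rfl h
      · have := HH_pos _ 0 vA (mem_mkL _ a x h)
        linarith
      · have := HH_pos _ 0 vB (mem_mkL _ b y h)
        linarith
    · have := main_list _ _ _ le_rfl vA vB hcf |c| (abs_pos.2 hc)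
      rw [sq_abs] at this
      linarith
  simp only [Nat.add_sub_cancel]
  rw [mul_assoc 2 (x 0) c, mul_assoc 2 c (y 0)]
  rw [mul_assoc 2 (x 0) c] at bA
  rw [mul_assoc 2 (y 0) c, mul_comm (y 0) c] at bB
  generalize x 0 * c = t1 at *
  generalize c * y 0 = t2 at *
  generalize c ^ 2 = t3 at *
  omega
end

section
/- Let Λ be a quasi-alternating lattice with vertex set V. Then for any non-zero x = Σ_{v∈V} c_v·v in Λ (with integer coefficients c_v), one has ‖x‖ ≥ 2 + Σ_{v∈V} |c_v|·(‖v‖ − 2). -/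
/-- The index set of the vertices of the star-shaped plumbing with central vertex
(`Sum.inl ()`) and three arms of lengths `k`, `l`, `m`.  Here `Sum.inr (Sum.inl i)`
represents the vertex `uᵃ_{i+1}`, etc. -/
abbrev QAIdx (k l m : ℕ) := Unit ⊕ (Fin k ⊕ (Fin l ⊕ Fin m))

/-- The pairing of the basis vectors (vertices) of the quasi-alternating lattice:
the central vertex has self-pairing `2`, the `i`-th vertex of each arm has
self-pairing given by the corresponding weight (`a`, `b` or `c`), consecutive
vertices of an arm and the central vertex with the first vertex of each arm pair
to `−1`, and all other pairings vanish. -/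
def qaForm (k l m : ℕ) (a b c : ℕ → ℤ) : QAIdx k l m → QAIdx k l m → ℤ
  | Sum.inl _, Sum.inl _ => 2
  | Sum.inl _, Sum.inr (Sum.inl i) => if i.val = 0 then -1 else 0
  | Sum.inr (Sum.inl i), Sum.inl _ => if i.val = 0 then -1 else 0
  | Sum.inl _, Sum.inr (Sum.inr (Sum.inl i)) => if i.val = 0 then -1 else 0
  | Sum.inr (Sum.inr (Sum.inl i)), Sum.inl _ => if i.val = 0 then -1 else 0
  | Sum.inl _, Sum.inr (Sum.inr (Sum.inr i)) => if i.val = 0 then -1 else 0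
  | Sum.inr (Sum.inr (Sum.inr i)), Sum.inl _ => if i.val = 0 then -1 else 0
  | Sum.inr (Sum.inl i), Sum.inr (Sum.inl j) =>
      if i = j then a i.val else if i.val + 1 = j.val ∨ j.val + 1 = i.val then -1 else 0
  | Sum.inr (Sum.inr (Sum.inl i)), Sum.inr (Sum.inr (Sum.inl j)) =>
      if i = j then b i.val else if i.val + 1 = j.val ∨ j.val + 1 = i.val then -1 else 0
  | Sum.inr (Sum.inr (Sum.inr i)), Sum.inr (Sum.inr (Sum.inr j)) =>
      if i = j then c i.val else if i.val + 1 = j.val ∨ j.val + 1 = i.val then -1 else 0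
  | _, _ => 0

/-- The symmetric bilinear form of the quasi-alternating lattice, on elements
written in coordinates with respect to the vertex basis. -/
def qaInner (k l m : ℕ) (a b c : ℕ → ℤ) (x y : QAIdx k l m → ℤ) : ℤ :=
  ∑ v : QAIdx k l m, ∑ w : QAIdx k l m, x v * y w * qaForm k l m a b c v w

/-- The vertex `v` as an element of the quasi-alternating lattice. -/
def qaBasis (k l m : ℕ) (v : QAIdx k l m) : QAIdx k l m → ℤ :=
  fun w => if w = v then 1 else 0

def qG : ℤ → List (ℤ × ℤ) → ℤ
  | _, [] => 0
  | n, p :: t => p.1 * p.2 ^ 2 - p.2 * (p.1 - 2) - 2 * n * p.2 + qG p.2 t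

def qR : List (ℤ × ℤ) → ℚ
  | [] => 0
  | p :: t => 1 / ((p.1 : ℚ) - qR t)

def qOK (A : List (ℤ × ℤ)) : Prop := ∀ p ∈ A, 2 ≤ p.1 ∧ 0 ≤ p.2

def qZ (A : List (ℤ × ℤ)) : Prop := ∀ p ∈ A, p.2 = 0

lemma qOK_cons (w x : ℤ) (t) : qOK ((w, x) :: t) ↔ 2 ≤ w ∧ 0 ≤ x ∧ qOK t := by
  simp [qOK, and_assoc]

lemma qZ_cons (w x : ℤ) (t) : qZ ((w, x) :: t) ↔ x = 0 ∧ qZ t := by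
  simp [qZ]

lemma sq_sub_nonneg' (x : ℤ) : 0 ≤ x ^ 2 - x := by
  nlinarith [Int.le_self_sq x]

lemma qG_lb (A : List (ℤ × ℤ)) : ∀ n : ℤ, qOK A → n - n ^ 2 ≤ qG n A := by
  induction A with
  | nil => intro n _; simp only [qG]; linarith [sq_sub_nonneg' n]
  | cons p t ih =>
    obtain ⟨w, x⟩ := p
    intro n h
    rw [qOK_cons] at h
    obtain ⟨hw, hx, ht⟩ := h
    have := ih x ht
    simp only [qG]
    nlinarith [mul_nonneg (sub_nonneg.2 hw) (sq_sub_nonneg' x), sq_sub_nonneg' (n - x)]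

lemma qG_zero (A : List (ℤ × ℤ)) : qOK A → (2 ≤ qG 0 A ∨ (qZ A ∧ qG 0 A = 0)) := by
  induction A with
  | nil => intro _; right; simp [qG, qZ]
  | cons p t ih =>
    obtain ⟨w, x⟩ := p
    intro h
    rw [qOK_cons] at h
    obtain ⟨hw, hx, ht⟩ := h
    rw [qZ_cons]
    rcases hx.eq_or_lt with h0 | h0
    · subst h0
      simpa [qG] using ih ht
    · left
      have := qG_lb t x ht
      simp only [qG]
      nlinarith [mul_nonneg (sub_nonneg.2 hw) (sq_sub_nonneg' x)]

lemma qR_bd (A : List (ℤ × ℤ)) : qOK A → 0 ≤ qR A ∧ qR A < 1 := by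
  induction A with
  | nil => intro _; simp [qR]
  | cons p t ih =>
    obtain ⟨w, x⟩ := p
    intro h
    rw [qOK_cons] at h
    obtain ⟨hw, hx, ht⟩ := h
    obtain ⟨h1, h2⟩ := ih ht
    have hw' : (2 : ℚ) ≤ w := by exact_mod_cast hw
    simp only [qR]
    constructor
    · apply div_nonneg <;> linarith
    · rw [div_lt_one] <;> linarith

/-- two arms around a chain vertex of weight at least two -/
lemma qG_two (a p : ℤ) (ha : 2 ≤ a) (hp : 0 ≤ p) (s t) (hs : qOK s) (ht : qOK t) :
    2 ≤ a * p ^ 2 - p * (a - 2) + qG p s + qG p t ∨ (p = 0 ∧ qZ s ∧ qZ t ∧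
      a * p ^ 2 - p * (a - 2) + qG p s + qG p t = 0) := by
  rcases hp.eq_or_lt with h0 | h0
  · subst h0
    rcases qG_zero s hs with h | h <;> rcases qG_zero t ht with h' | h'
    · left; linarith
    · left; linarith
    · left; linarith
    · right; refine ⟨rfl, h.1, h'.1, ?_⟩; linarith
  · left
    have := qG_lb s p hs
    have := qG_lb t p ht
    nlinarith [mul_nonneg (sub_nonneg.2 ha) (sq_sub_nonneg' p)]

lemma qR_step (u v : ℚ) (w : ℚ) (hu : 0 ≤ u) (hu1 : u < 1) (hv : 0 ≤ v) (hv1 : v < 1) (hw : 3 ≤ w)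
    (h : 1 / (2 - u) + 1 / (w - v) < 1) : u + 1 / (w - 1 - v) < 1 := by
  have h1 : 0 < 2 - u := by linarith
  have h2 : 0 < w - v := by linarith
  have h3 : 0 < w - 1 - v := by linarith
  rw [div_add_div _ _ h1.ne' h2.ne', div_lt_one (by positivity)] at h
  have : 1 / (w - 1 - v) < 1 - u := by
    rw [div_lt_iff₀ h3]; nlinarith
  linarith

lemma qR_22 (u v : ℚ) (hu : 0 ≤ u) (hu1 : u < 1) (hv : 0 ≤ v) (hv1 : v < 1)
    (h : 1 / (2 - u) + 1 / (2 - v) < 1) : False := by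
  have h1 : 0 < 2 - u := by linarith
  have h2 : 0 < 2 - v := by linarith
  rw [div_add_div _ _ h1.ne' h2.ne', div_lt_one (by positivity)] at h
  nlinarith

lemma q_fin (d n X : ℤ) (h : 2 ≤ X) : 2 ≤ d ^ 2 + d + X := by
  have := sq_sub_nonneg' (-d)
  linarith [neg_sq d]

lemma qMain (N : ℕ) : ∀ (A B : List (ℤ × ℤ)) (n : ℤ), A.length + B.length ≤ N → 0 ≤ n →
    qOK A → qOK B → qR A + qR B < 1 →
    2 ≤ n ^ 2 + n + qG n A + qG n B ∨
      (n = 0 ∧ qZ A ∧ qZ B ∧ n ^ 2 + n + qG n A + qG n B = 0) := by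
  induction N with
  | zero =>
    intro A B n hN hn hA hB hR
    have hA0 : A = [] := List.length_eq_zero_iff.1 (by omega)
    have hB0 : B = [] := List.length_eq_zero_iff.1 (by omega)
    subst hA0 hB0
    rcases hn.eq_or_lt with h0 | h0
    · right; subst h0; simp [qZ, qG]
    · left; simp only [qG]; nlinarith
  | succ N ih =>
    have key1 : ∀ (B : List (ℤ × ℤ)) (n : ℤ), B.length ≤ N + 1 → 0 ≤ n → qOK B →
        2 ≤ n ^ 2 + n + qG n B ∨ (n = 0 ∧ qZ B ∧ n ^ 2 + n + qG n B = 0) := by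
      intro B n hN hn hB
      have hnn : n = 0 ∨ 2 ≤ n ^ 2 + n := by
        rcases hn.eq_or_lt with h0 | h0
        · left; exact h0.symm
        · right; nlinarith
      cases B with
      | nil =>
        rcases hnn with h0 | h0
        · right; subst h0; simp [qZ, qG]
        · left; simpa only [qG, add_zero] using h0
      | cons y t =>
        obtain ⟨w, q⟩ := y
        rw [qOK_cons] at hB
        obtain ⟨hw, hq, ht⟩ := hB
        have E : n ^ 2 + n + qG n ((w, q) :: t) = (n - q) ^ 2 + (n - q) +
            ((w - 1) * q ^ 2 - q * (w - 1 - 2) + qG q t) := by simp only [qG]; ring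
        have K : 2 ≤ (w - 1) * q ^ 2 - q * (w - 1 - 2) + qG q t ∨ (q = 0 ∧ qZ t ∧
            (w - 1) * q ^ 2 - q * (w - 1 - 2) + qG q t = 0) := by
          rcases hw.eq_or_lt with h2 | h2
          · subst h2
            have := ih [] t q (by simpa using hN) hq (by simp [qOK]) ht
              (by simpa [qR] using (qR_bd t ht).2)
            simp only [qG] at this
            ring_nf at this ⊢
            tauto
          · have := qG_two (w - 1) q (by linarith) hq t [] ht (by simp [qOK])
            simp only [qG, add_zero] at this
            tauto
        rw [E, qZ_cons]
        rcases K with K | ⟨rfl, K2, K3⟩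
        · left; exact q_fin _ n _ K
        · rw [K3]
          rcases hnn with h0 | h0
          · right; subst h0; simp [K2]
          · left; simpa using h0
    have key2 : ∀ (s t : List (ℤ × ℤ)) (w p q n : ℤ), s.length + 1 + (t.length + 1) ≤ N + 1 →
        0 ≤ n → 0 ≤ p → 0 ≤ q → 2 ≤ w → qOK s → qOK t → qR ((2, p) :: s) + qR ((w, q) :: t) < 1 →
        2 ≤ n ^ 2 + n + qG n ((2, p) :: s) + qG n ((w, q) :: t) ∨
        (n = 0 ∧ qZ ((2, p) :: s) ∧ qZ ((w, q) :: t) ∧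
          n ^ 2 + n + qG n ((2, p) :: s) + qG n ((w, q) :: t) = 0) := by
      intro s t w p q n hN hn hp hq hw hs ht hR
      have hnn : n = 0 ∨ 2 ≤ n ^ 2 + n := by
        rcases hn.eq_or_lt with h0 | h0
        · left; exact h0.symm
        · right; nlinarith
      obtain ⟨u0, u1⟩ := qR_bd s hs
      obtain ⟨v0, v1⟩ := qR_bd t ht
      simp only [qR] at hR
      push_cast at hR
      have hw3 : 3 ≤ w := by
        by_contra hcon
        have : w = 2 := by omega
        subst this
        exact qR_22 _ _ u0 u1 v0 v1 (by simpa using hR)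
      have hw3' : (3 : ℚ) ≤ w := by exact_mod_cast hw3
      have hR2 := qR_step _ _ _ u0 u1 v0 v1 hw3' hR
      have K := ih s ((w - 1, q) :: t) p (by simp only [List.length_cons]; omega) hp hs
        ((qOK_cons _ _ _).2 ⟨by linarith, hq, ht⟩)
        (by simp only [qR]; push_cast; exact hR2)
      have E : n ^ 2 + n + qG n ((2, p) :: s) + qG n ((w, q) :: t) =
          (n - p - q) ^ 2 + (n - p - q) + (p ^ 2 + p + qG p s + qG p ((w - 1, q) :: t)) := by
        simp only [qG]; ring
      rw [E]
      simp only [qZ_cons] at K ⊢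
      rcases K with K | ⟨rfl, K1, ⟨rfl, K2⟩, K3⟩
      · left; exact q_fin _ n _ K
      · rw [K3]
        rcases hnn with h0 | h0
        · right; subst h0; simp [K1, K2]
        · left; simpa using h0
    intro A B n hN hn hA hB hR
    have hnn : n = 0 ∨ 2 ≤ n ^ 2 + n := by
      rcases hn.eq_or_lt with h0 | h0
      · left; exact h0.symm
      · right; nlinarith
    match A, B with
    | [], B =>
      have := key1 B n (by simpa using hN) hn hB
      simpa [qG, qZ] using this
    | A, [] =>
      have := key1 A n (by simpa using hN) hn hA
      simpa [qG, qZ] using this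
    | (a, p) :: s, (b, q) :: t =>
      have hA' := (qOK_cons _ _ _).1 hA
      have hB' := (qOK_cons _ _ _).1 hB
      obtain ⟨ha, hp, hs⟩ := hA'
      obtain ⟨hb, hq, ht⟩ := hB'
      simp only [List.length_cons] at hN
      rcases ha.eq_or_lt with ha2 | ha2
      · subst ha2
        exact key2 s t b p q n hN hn hp hq hb hs ht hR
      rcases hb.eq_or_lt with hb2 | hb2
      · subst hb2
        have := key2 t s a q p n (by omega) hn hq hp ha ht hs (by linarith)
        rw [add_right_comm] at this
        tauto
      have K := qG_two (a - 1) p (by linarith) hp s ((b - 1, q) :: t) hs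
        ((qOK_cons _ _ _).2 ⟨by linarith, hq, ht⟩)
      have E : n ^ 2 + n + qG n ((a, p) :: s) + qG n ((b, q) :: t) =
          (n - p - q) ^ 2 + (n - p - q) + ((a - 1) * p ^ 2 - p * (a - 1 - 2) + qG p s
            + qG p ((b - 1, q) :: t)) := by
        simp only [qG]; ring
      rw [E]
      simp only [qZ_cons] at K ⊢
      rcases K with K | ⟨rfl, K1, ⟨rfl, K2⟩, K3⟩
      · left; exact q_fin _ n _ K
      · rw [K3]
        rcases hnn with h0 | h0
        · right; subst h0; simp [K1, K2]
        · left; simpa using h0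

lemma qTotal (A B C : List (ℤ × ℤ)) (n : ℤ) (hn : 0 ≤ n) (hA : qOK A) (hB : qOK B) (hC : qOK C)
    (hR : qR A + qR B < 1) :
    2 ≤ 2 * n ^ 2 + qG n A + qG n B + qG n C ∨ (n = 0 ∧ qZ A ∧ qZ B ∧ qZ C) := by
  rcases hn.eq_or_lt with h0 | h0
  · subst h0
    rcases qG_zero A hA with h | h <;> rcases qG_zero B hB with h' | h' <;>
      rcases qG_zero C hC with h'' | h''
    all_goals first
      | (left; linarith)
      | exact Or.inr ⟨rfl, h.1, h'.1, h''.1⟩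
  · left
    have := qG_lb C n hC
    rcases qMain _ A B n le_rfl hn hA hB hR with h | h
    · linarith
    · omega

def qmk : (k : ℕ) → (ℕ → ℤ) → (Fin k → ℤ) → List (ℤ × ℤ)
  | 0, _, _ => []
  | k + 1, a, x => (a 0, |x 0|) :: qmk k (fun i => a (i + 1)) (fun i => x i.succ)

lemma qmk_OK (k : ℕ) : ∀ (a : ℕ → ℤ) (x : Fin k → ℤ), (∀ i < k, 2 ≤ a i) → qOK (qmk k a x) := by
  induction k with
  | zero => intro a x _; simp [qmk, qOK]
  | succ k ih =>
    intro a x h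
    simp only [qmk, qOK_cons]
    exact ⟨h 0 (by omega), abs_nonneg _, ih _ _ (fun i hi => h (i + 1) (by omega))⟩

lemma qmk_Z (k : ℕ) : ∀ (a : ℕ → ℤ) (x : Fin k → ℤ), qZ (qmk k a x) → ∀ i, x i = 0 := by
  induction k with
  | zero => intro a x _ i; exact i.elim0
  | succ k ih =>
    intro a x h i
    simp only [qmk, qZ_cons] at h
    refine Fin.cases ?_ (fun j => ?_) i
    · exact abs_eq_zero.1 h.1
    · exact ih _ _ h.2 j

lemma qmk_R (k : ℕ) : ∀ (a : ℕ → ℤ) (x : Fin (k + 1) → ℤ),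
    qR (qmk (k + 1) a x) = 1 / negCF a (k + 1) := by
  induction k with
  | zero => intro a x; simp [qmk, qR, negCF]
  | succ k ih =>
    intro a x
    rw [qmk, qR, ih, negCF]

def qP (k : ℕ) (n : ℤ) (a : ℕ → ℤ) (x : Fin k → ℤ) : ℤ :=
  (∑ i : Fin k, ∑ j : Fin k, x i * x j *
    (if i = j then a i.val else if i.val + 1 = j.val ∨ j.val + 1 = i.val then -1 else 0))
  + 2 * ∑ i : Fin k, n * x i * (if i.val = 0 then -1 else 0)

lemma qP_succ (k : ℕ) (n : ℤ) (a : ℕ → ℤ) (x : Fin (k + 1) → ℤ) :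
    qP (k + 1) n a x = a 0 * x 0 ^ 2 - 2 * n * x 0 +
      qP k (x 0) (fun i => a (i + 1)) (fun i => x i.succ) := by
  have e1 : ∀ j : Fin k, (0 : Fin (k + 1)) ≠ j.succ := fun j => (Fin.succ_ne_zero j).symm
  have e2 : ∀ j : Fin k, (0 = (j : ℕ)) = ((j : ℕ) = 0) := fun j => propext eq_comm
  simp only [qP, Fin.sum_univ_succ, Fin.succ_inj, Fin.val_succ, Fin.val_zero, if_true,
    Fin.succ_ne_zero, e1, if_false, Nat.add_right_cancel_iff, Nat.succ_ne_zero, or_false, false_or,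
    Finset.sum_add_distrib, zero_add, Nat.right_eq_add, Nat.add_eq_right, mul_zero,
    Finset.sum_const_zero, add_zero, e2]
  have e3 : ∑ j : Fin k, x j.succ * x 0 * (if (j : ℕ) = 0 then (-1 : ℤ) else 0) =
     ∑ j : Fin k, x 0 * x j.succ * (if (j : ℕ) = 0 then (-1 : ℤ) else 0) :=
    Finset.sum_congr rfl fun j _ => by ring
  rw [e3]
  ring

lemma qP_lb (k : ℕ) : ∀ (n : ℤ) (a : ℕ → ℤ) (x : Fin k → ℤ),
    qG |n| (qmk k a x) ≤ qP k n a x - ∑ i : Fin k, |x i| * (a i - 2) := by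
  induction k with
  | zero => intro n a x; simp [qmk, qG, qP]
  | succ k ih =>
    intro n a x
    have := ih (x 0) (fun i => a (i + 1)) (fun i => x i.succ)
    rw [qP_succ, Fin.sum_univ_succ]
    simp only [qmk, qG, sq_abs, Fin.val_succ, Fin.val_zero]
    have h1 : n * x 0 ≤ |n| * |x 0| := by rw [← abs_mul]; exact le_abs_self _
    linarith

lemma qInner_eq (k l m : ℕ) (a b c : ℕ → ℤ) (x : QAIdx k l m → ℤ) :
    qaInner k l m a b c x x = 2 * (x (Sum.inl ())) ^ 2
      + qP k (x (Sum.inl ())) a (fun i => x (Sum.inr (Sum.inl i)))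
      + qP l (x (Sum.inl ())) b (fun i => x (Sum.inr (Sum.inr (Sum.inl i))))
      + qP m (x (Sum.inl ())) c (fun i => x (Sum.inr (Sum.inr (Sum.inr i)))) := by
  simp only [qaInner, qP, Fintype.sum_sum_type, qaForm, Finset.univ_unique, Finset.sum_singleton,
    Finset.sum_add_distrib, mul_zero, Finset.sum_const_zero, add_zero, zero_add,
    PUnit.default_eq_unit]
  have e (r : ℕ) (y : Fin r → ℤ) :
     ∑ j : Fin r, y j * x (Sum.inl ()) * (if (j : ℕ) = 0 then (-1 : ℤ) else 0) =
     ∑ j : Fin r, x (Sum.inl ()) * y j * (if (j : ℕ) = 0 then (-1 : ℤ) else 0) :=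
    Finset.sum_congr rfl fun j _ => by ring
  rw [e k (fun i => x (Sum.inr (Sum.inl i))), e l (fun i => x (Sum.inr (Sum.inr (Sum.inl i)))),
    e m (fun i => x (Sum.inr (Sum.inr (Sum.inr i))))]
  ring

/-- In a quasi-alternating lattice, every non-zero element `x = Σ c_v v` satisfies
`‖x‖ ≥ 2 + Σ_v |c_v|(‖v‖ − 2)`.  Here `x : QAIdx k l m → ℤ` records the coefficients
`c_v` of `x` with respect to the vertex basis, and `‖v‖ = qaForm … v v`. -/
theorem stmt_5 (k l m : ℕ) (hk : 1 ≤ k) (hl : 1 ≤ l) (hm : 1 ≤ m)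
    (a b c : ℕ → ℤ)
    (ha : ∀ i < k, 2 ≤ a i) (hb : ∀ i < l, 2 ≤ b i) (hc : ∀ i < m, 2 ≤ c i)
    (hcf : 1 / negCF a k + 1 / negCF b l < 1)
    (x : QAIdx k l m → ℤ) (hx : x ≠ 0) :
    qaInner k l m a b c x x
      ≥ 2 + ∑ v : QAIdx k l m, |x v| * (qaForm k l m a b c v v - 2) := by
  obtain ⟨k, rfl⟩ : ∃ k', k = k' + 1 := ⟨k - 1, by omega⟩
  obtain ⟨l, rfl⟩ : ∃ l', l = l' + 1 := ⟨l - 1, by omega⟩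
  have T := qTotal (qmk (k + 1) a (fun i => x (Sum.inr (Sum.inl i))))
    (qmk (l + 1) b (fun i => x (Sum.inr (Sum.inr (Sum.inl i)))))
    (qmk m c (fun i => x (Sum.inr (Sum.inr (Sum.inr i))))) |x (Sum.inl ())| (abs_nonneg _)
    (qmk_OK _ _ _ ha) (qmk_OK _ _ _ hb) (qmk_OK _ _ _ hc) (by rw [qmk_R, qmk_R]; exact hcf)
  rcases T with T | ⟨T0, T1, T2, T3⟩
  · have h1 := qP_lb (k + 1) (x (Sum.inl ())) a (fun i => x (Sum.inr (Sum.inl i)))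
    have h2 := qP_lb (l + 1) (x (Sum.inl ())) b (fun i => x (Sum.inr (Sum.inr (Sum.inl i))))
    have h3 := qP_lb m (x (Sum.inl ())) c (fun i => x (Sum.inr (Sum.inr (Sum.inr i))))
    rw [qInner_eq]
    rw [sq_abs] at T
    simp only [Fintype.sum_sum_type, qaForm, if_true, sub_self, mul_zero, Finset.sum_const_zero,
      zero_add]
    linarith
  · exfalso
    apply hx
    funext v
    rcases v with v | v | v | v
    · exact abs_eq_zero.1 T0
    · exact qmk_Z _ _ _ T1 v
    · exact qmk_Z _ _ _ T2 v
    · exact qmk_Z _ _ _ T3 v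
end

section
/- Let Λ be a quasi-alternating lattice with vertex set V. Then: (i) every non-zero x ∈ Λ satisfies ‖x‖ ≥ 2; and (ii) if x = Σ_{v∈V} c_v·v with integer coefficients and c_w ≠ 0 for some vertex w ∈ V, then ‖x‖ ≥ ‖w‖. -/
/-- arm contribution -/
def qaArm : ℤ → List (ℤ × ℤ) → ℤ
  | _, [] => 0
  | s, p :: A => -2 * s * p.2 + p.1 * p.2 ^ 2 - (p.1 - 2) * p.2 + qaArm p.2 A

/-- reciprocal continued fraction -/
def qaR : List (ℤ × ℤ) → ℚ
  | [] => 0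
  | p :: A => 1 / ((p.1 : ℚ) - qaR A)

/-- list of an arm -/
def qaL : (k : ℕ) → (ℕ → ℤ) → (Fin k → ℤ) → List (ℤ × ℤ)
  | 0, _, _ => []
  | k + 1, a, y => (a 0, y 0) :: qaL k (fun i => a (i + 1)) (fun i => y i.succ)

/-- admissible lists -/
def qaOK (A : List (ℤ × ℤ)) : Prop := ∀ p ∈ A, 2 ≤ p.1 ∧ 0 ≤ p.2

theorem qaOK_cons {p : ℤ × ℤ} {A : List (ℤ × ℤ)} :
    qaOK (p :: A) ↔ (2 ≤ p.1 ∧ 0 ≤ p.2) ∧ qaOK A := by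
  simp [qaOK]

theorem qaR_bd (A : List (ℤ × ℤ)) (h : qaOK A) : 0 ≤ qaR A ∧ qaR A < 1 := by
  induction A with
  | nil => simp [qaR]
  | cons p A ih =>
    rw [qaOK_cons] at h
    obtain ⟨h0, h1⟩ := ih h.2
    have h2 : (2 : ℚ) ≤ p.1 := by exact_mod_cast h.1.1
    have h3 : 0 < (p.1 : ℚ) - qaR A := by linarith
    simp only [qaR]
    refine ⟨by positivity, ?_⟩
    rw [div_lt_one h3]; linarith

theorem qa_sq (y : ℤ) : 0 ≤ y ^ 2 - y := by
  rcases le_or_gt y 0 with h | h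
  · nlinarith
  · have : 1 ≤ y := h
    nlinarith

theorem qaArm_ge (A : List (ℤ × ℤ)) (h : qaOK A) (s : ℤ) : s ≤ s ^ 2 + qaArm s A := by
  induction A generalizing s with
  | nil => have := qa_sq s; simp [qaArm]; linarith
  | cons p A ih =>
    rw [qaOK_cons] at h
    have h1 := ih h.2 p.2
    have h2 := mul_nonneg (sub_nonneg.2 h.1.1) (qa_sq p.2)
    have h3 := qa_sq (s - p.2)
    simp only [qaArm]
    nlinarith

theorem qaArm_two (A : List (ℤ × ℤ)) (h : qaOK A) (hn : ∃ p ∈ A, p.2 ≠ 0) : 2 ≤ qaArm 0 A := by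
  induction A with
  | nil => simp at hn
  | cons p A ih =>
    rw [qaOK_cons] at h
    by_cases hp : p.2 = 0
    · have : ∃ q ∈ A, q.2 ≠ 0 := by
        obtain ⟨q, hq, hq2⟩ := hn
        rcases List.mem_cons.1 hq with rfl | hq
        · exact absurd hp hq2
        · exact ⟨q, hq, hq2⟩
      have := ih h.2 this
      simp only [qaArm, hp]
      linarith
    · have hp1 : 1 ≤ p.2 := by have := h.1.2; omega
      have h1 := qaArm_ge A h.2 p.2
      have h2 := mul_nonneg (sub_nonneg.2 h.1.1) (qa_sq p.2)
      simp only [qaArm]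
      nlinarith

theorem qaArm_zero (A : List (ℤ × ℤ)) (h : qaOK A) : 0 ≤ qaArm 0 A := by
  have := qaArm_ge A h 0
  simpa using this

theorem qa_tt (t : ℤ) : 0 ≤ t ^ 2 + t := by
  have := qa_sq (-t); linarith [neg_sq t]

/-- some coordinate is nonzero -/
def qaNZ (s : ℤ) (A B : List (ℤ × ℤ)) : Prop :=
  s ≠ 0 ∨ (∃ p ∈ A, p.2 ≠ 0) ∨ (∃ p ∈ B, p.2 ≠ 0)

/-- value on the linear chain -/
def qaG (s : ℤ) (A B : List (ℤ × ℤ)) : ℤ := s ^ 2 + s + qaArm s A + qaArm s B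

theorem qaG_comm (s : ℤ) (A B : List (ℤ × ℤ)) : qaG s A B = qaG s B A := by
  unfold qaG; ring

theorem qaNZ_comm (s : ℤ) (A B : List (ℤ × ℤ)) : qaNZ s A B → qaNZ s B A := by
  rintro (h | h | h)
  · exact Or.inl h
  · exact Or.inr (Or.inr h)
  · exact Or.inr (Or.inl h)

theorem qa_two_of_pos {t : ℤ} (h : 1 ≤ t) : 2 ≤ t ^ 2 + t := by nlinarith

/-- all remaining coordinates vanish -/
theorem qaArm_allzero (A : List (ℤ × ℤ)) (h : ¬ ∃ p ∈ A, p.2 ≠ 0) : qaArm 0 A = 0 := by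
  induction A with
  | nil => rfl
  | cons p A ih =>
    push Not at h
    have h0 := h p (by simp)
    have := ih (by push Not; exact fun q hq => h q (by simp [hq]))
    simp [qaArm, h0, this]

theorem qaG_zero_side (s : ℤ) (A B : List (ℤ × ℤ)) (hs : 0 ≤ s) (hnz : qaNZ s A B)
    (h1 : ¬ ∃ p ∈ A, p.2 ≠ 0) (h2 : ¬ ∃ p ∈ B, p.2 ≠ 0) : 1 ≤ s := by
  unfold qaNZ at hnz
  rcases hnz with h | h | h
  · omega
  · exact absurd h h1
  · exact absurd h h2

theorem qa_zero_arms (A B : List (ℤ × ℤ)) (hA : qaOK A) (hB : qaOK B)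
    (h : (∃ p ∈ A, p.2 ≠ 0) ∨ (∃ p ∈ B, p.2 ≠ 0)) : 2 ≤ qaArm 0 A + qaArm 0 B := by
  rcases h with h | h
  · linarith [qaArm_two A hA h, qaArm_zero B hB]
  · linarith [qaArm_two B hB h, qaArm_zero A hA]

theorem qa_cf {p q : ℚ} (hp : 1 < p) (hq : 1 < q) (h : 1 / p + 1 / q < 1) :
    1 / (q - 1) < p - 1 := by
  have hp0 : 0 < p := by linarith
  have hq0 : 0 < q := by linarith
  have hq1 : 0 < q - 1 := by linarith
  rw [div_add_div _ _ hp0.ne' hq0.ne', div_lt_one (by positivity)] at h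
  rw [div_lt_iff₀ hq1]
  nlinarith

/-- case of a first weight two on the first arm -/
theorem qaG_step (n : ℕ)
    (ih : ∀ (s : ℤ) (A B : List (ℤ × ℤ)), A.length + B.length = n → qaOK A → qaOK B →
      0 ≤ s → qaR A + qaR B < 1 → qaNZ s A B → 2 ≤ qaG s A B)
    (s y : ℤ) (A B : List (ℤ × ℤ)) (hl : A.length + B.length = n) (hA : qaOK A) (hB : qaOK B)
    (hs : 0 ≤ s) (hy : 0 ≤ y) (hr : qaR ((2, y) :: A) + qaR B < 1)
    (hnz : qaNZ s ((2, y) :: A) B) : 2 ≤ qaG s ((2, y) :: A) B := by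
  have bA := qaR_bd A hA
  cases B with
  | nil =>
    have e : qaG s ((2, y) :: A) [] = ((s - y) ^ 2 + (s - y)) + qaG y A [] := by
      simp only [qaG, qaArm]; ring
    rw [e]
    by_cases h : qaNZ y A []
    · have := ih y A [] hl hA hB hy (by simpa [qaR] using bA.2) h
      linarith [qa_tt (s - y)]
    · simp only [qaNZ, not_or] at h
      have hy0 : y = 0 := by tauto
      subst hy0
      have : 1 ≤ s := qaG_zero_side s _ _ hs hnz (by simpa using h.2.1) h.2.2
      have h2 := qaArm_allzero A h.2.1
      have := qa_two_of_pos this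
      simp only [qaG, qaArm, h2]; linarith
  | cons q B =>
    obtain ⟨b, z⟩ := q
    have hB' := qaOK_cons.1 hB
    have bB := qaR_bd B hB'.2
    simp only at hB'
    have hb2 : (2 : ℚ) ≤ b := by exact_mod_cast hB'.1.1
    have hcf : 1 / (((b : ℚ) - qaR B) - 1) < ((2 : ℤ) - qaR A) - 1 := by
      apply qa_cf
      · push_cast; linarith
      · linarith
      · simpa only [qaR] using hr
    have hb3 : 3 ≤ b := by
      by_contra hlt
      have hb : b = 2 := by omega
      subst hb
      have h1 : 0 < ((2 : ℤ) : ℚ) - qaR B - 1 := by push_cast; linarith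
      rw [div_lt_iff₀ h1] at hcf
      push_cast at hcf
      nlinarith
    have e : qaG s ((2, y) :: A) ((b, z) :: B) =
        ((s - y - z) ^ 2 + (s - y - z)) + qaG y A ((b - 1, z) :: B) := by
      simp only [qaG, qaArm]; ring
    rw [e]
    by_cases h : qaNZ y A ((b - 1, z) :: B)
    · have := ih y A ((b - 1, z) :: B) (by simpa using hl) hA
        (qaOK_cons.2 ⟨⟨by simp only; omega, hB'.1.2⟩, hB'.2⟩) hy
        (by
          simp only [qaR]
          have e2 : (((b - 1 : ℤ) : ℚ) - qaR B) = ((b : ℚ) - qaR B) - 1 := by push_cast; ring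
          rw [e2]
          push_cast at hcf
          linarith) h
      linarith [qa_tt (s - y - z)]
    · simp only [qaNZ, not_or] at h
      have hy0 : y = 0 := by tauto
      subst hy0
      have hz : z = 0 := by
        by_contra hz
        exact h.2.2 ⟨(b - 1, z), by simp, hz⟩
      subst hz
      have : 1 ≤ s := qaG_zero_side s _ _ hs hnz (by simpa using h.2.1) (by simpa using h.2.2)
      have h2 := qaArm_allzero A h.2.1
      have h3 := qaArm_allzero B (by simpa using h.2.2)
      have := qa_two_of_pos this
      simp only [qaG, qaArm, h2, h3]; linarith

theorem qaG_one (s z b : ℤ) (B : List (ℤ × ℤ)) (hb : 3 ≤ b) (hB : qaOK B) (hs : 0 ≤ s)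
    (hz : 0 ≤ z) (hnz : qaNZ s [] ((b, z) :: B)) : 2 ≤ qaG s [] ((b, z) :: B) := by
  have e : qaG s [] ((b, z) :: B) =
      ((s - z) ^ 2 + (s - z)) + (b - 3) * (z ^ 2 - z) + (2 * z ^ 2 + qaArm z B) := by
    simp only [qaG, qaArm]; ring
  have h0 := qa_tt (s - z)
  have h1 := mul_nonneg (sub_nonneg.2 hb) (qa_sq z)
  have h2 := qaArm_ge B hB z
  rw [e]
  rcases hz.eq_or_lt with h | h
  · subst h
    by_cases hn : ∃ p ∈ B, p.2 ≠ 0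
    · have := qaArm_two B hB hn
      linarith
    · have : 1 ≤ s := qaG_zero_side s _ _ hs hnz (by simp) (by simpa using hn)
      have := qa_two_of_pos this
      rw [qaArm_allzero B hn]; linarith
  · have : 1 ≤ z := h
    nlinarith

theorem qaG_both (s y z a b : ℤ) (A B : List (ℤ × ℤ)) (ha : 3 ≤ a) (hb : 3 ≤ b)
    (hA : qaOK A) (hB : qaOK B) (hs : 0 ≤ s) (hy : 0 ≤ y)
    (hz : 0 ≤ z) (hnz : qaNZ s ((a, y) :: A) ((b, z) :: B)) :
    2 ≤ qaG s ((a, y) :: A) ((b, z) :: B) := by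
  have e : qaG s ((a, y) :: A) ((b, z) :: B) =
      ((s - y - z) ^ 2 + (s - y - z)) + (a - 3) * (y ^ 2 - y) + (b - 3) * (z ^ 2 - z)
      + (y - z) ^ 2 + (y ^ 2 + qaArm y A) + (z ^ 2 + qaArm z B) := by
    simp only [qaG, qaArm]; ring
  have h0 := qa_tt (s - y - z)
  have h1 := mul_nonneg (sub_nonneg.2 hb) (qa_sq z)
  have h1' := mul_nonneg (sub_nonneg.2 ha) (qa_sq y)
  have h2 := qaArm_ge B hB z
  have h2' := qaArm_ge A hA y
  have h3 := sq_nonneg (y - z)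
  rw [e]
  by_cases hyz : 2 ≤ y + z
  · linarith
  · have : (y = 0 ∧ z = 0) ∨ (y = 0 ∧ z = 1) ∨ (y = 1 ∧ z = 0) := by omega
    rcases this with ⟨rfl, rfl⟩ | ⟨rfl, rfl⟩ | ⟨rfl, rfl⟩
    · by_cases hn : (∃ p ∈ A, p.2 ≠ 0) ∨ (∃ p ∈ B, p.2 ≠ 0)
      · have := qa_zero_arms A B hA hB hn
        linarith
      · rw [not_or] at hn
        have : 1 ≤ s := qaG_zero_side s _ _ hs hnz (by simpa using hn.1) (by simpa using hn.2)
        have := qa_two_of_pos this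
        rw [qaArm_allzero A hn.1, qaArm_allzero B hn.2]; linarith
    · linarith
    · linarith

theorem qaG_ge (n : ℕ) : ∀ (s : ℤ) (A B : List (ℤ × ℤ)), A.length + B.length = n →
    qaOK A → qaOK B → 0 ≤ s → qaR A + qaR B < 1 → qaNZ s A B → 2 ≤ qaG s A B := by
  induction n with
  | zero =>
    intro s A B hl hA hB hs hr hnz
    have h1 : A = [] := List.length_eq_zero_iff.1 (by omega)
    have h2 : B = [] := List.length_eq_zero_iff.1 (by omega)
    subst h1 h2
    have := qaG_zero_side s _ _ hs hnz (by simp) (by simp)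
    have := qa_two_of_pos this
    simp only [qaG, qaArm]; linarith
  | succ n ih =>
    intro s A B hl hA hB hs hr hnz
    match A, B with
    | [], [] => simp at hl
    | (a, y) :: A, B =>
      have hA' := qaOK_cons.1 hA
      simp only at hA'
      by_cases ha : a = 2
      · subst ha
        exact qaG_step n ih s y A B (by simp at hl; omega) hA'.2 hB hs hA'.1.2 hr hnz
      · match B with
        | [] =>
          rw [qaG_comm]
          exact qaG_one s y a A (by omega) hA'.2 hs hA'.1.2 (qaNZ_comm _ _ _ hnz)
        | (b, z) :: B =>
          have hB' := qaOK_cons.1 hB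
          simp only at hB'
          by_cases hb : b = 2
          · subst hb
            rw [qaG_comm]
            exact qaG_step n ih s z B ((a, y) :: A) (by simp at hl ⊢; omega) hB'.2 hA hs hB'.1.2
              (by linarith) (qaNZ_comm _ _ _ hnz)
          · exact qaG_both s y z a b A B (by omega) (by omega) hA'.2 hB'.2 hs hA'.1.2 hB'.1.2 hnz
    | [], (b, z) :: B =>
      have hB' := qaOK_cons.1 hB
      simp only at hB'
      by_cases hb : b = 2
      · subst hb
        rw [qaG_comm]
        exact qaG_step n ih s z B [] (by simp at hl ⊢; omega) hB'.2 hA hs hB'.1.2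
          (by linarith) (qaNZ_comm _ _ _ hnz)
      · exact qaG_one s z b B (by omega) hB'.2 hs hB'.1.2 hnz

theorem qaR_L (k : ℕ) (a : ℕ → ℤ) (y : Fin (k + 1) → ℤ) :
    qaR (qaL (k + 1) a y) = 1 / negCF a (k + 1) := by
  induction k generalizing a with
  | zero => simp [qaL, qaR, negCF]
  | succ k ih =>
    rw [qaL, qaR, ih, negCF]

theorem qaOK_L (k : ℕ) (a : ℕ → ℤ) (y : Fin k → ℤ) (ha : ∀ i < k, 2 ≤ a i) (hy : ∀ i, 0 ≤ y i) :
    qaOK (qaL k a y) := by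
  induction k generalizing a with
  | zero => simp [qaL, qaOK]
  | succ k ih =>
    rw [qaL, qaOK_cons]
    exact ⟨⟨ha 0 (by omega), hy 0⟩, ih _ _ (fun i hi => ha (i + 1) (by omega)) (fun i => hy _)⟩

theorem qaNZ_L (k : ℕ) (a : ℕ → ℤ) (y : Fin k → ℤ) (i : Fin k) (hi : y i ≠ 0) :
    ∃ p ∈ qaL k a y, p.2 ≠ 0 := by
  induction k generalizing a with
  | zero => exact i.elim0
  | succ k ih =>
    rw [qaL]
    refine Fin.cases (fun hi => ⟨(a 0, y 0), by simp, hi⟩) (fun j hj => ?_) i hi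
    obtain ⟨p, hp, hp2⟩ := ih (fun i => a (i + 1)) (fun i => y i.succ) j hj
    exact ⟨p, by simp [hp], hp2⟩

theorem qaArm_L (k : ℕ) (a : ℕ → ℤ) (y : Fin k → ℤ) (s : ℤ) :
    qaArm s (qaL k a y) = (∑ j : Fin k, s * y j * (if j.val = 0 then -1 else 0)) +
      (∑ j : Fin k, y j * s * (if j.val = 0 then -1 else 0)) +
      (∑ i : Fin k, ∑ j : Fin k, y i * y j * (if i = j then a i.val else
        if i.val + 1 = j.val ∨ j.val + 1 = i.val then -1 else 0)) -
      ∑ i : Fin k, (a i.val - 2) * y i := by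
  induction k generalizing a s with
  | zero => simp [qaL, qaArm]
  | succ k ih =>
    rw [qaL, qaArm, ih]
    simp only [Fin.sum_univ_succ, Finset.sum_add_distrib]
    simp only [Fin.val_zero, Fin.val_succ, Fin.succ_inj, if_true, Nat.add_eq_zero_iff,
      one_ne_zero, and_false, if_false, mul_zero, Finset.sum_const_zero, add_zero,
      Fin.succ_ne_zero, (Fin.succ_ne_zero _).symm, zero_add, Nat.add_right_cancel_iff, or_false,
      false_or, eq_comm (a := (1 : ℕ)), reduceCtorEq, Nat.add_eq_right]
    ring

theorem qaForm_off (k l m : ℕ) (a b c : ℕ → ℤ) (v w : QAIdx k l m) (h : v ≠ w) :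
    qaForm k l m a b c v w ≤ 0 := by
  rcases v with v | v | v | v <;> rcases w with w | w | w | w <;>
    simp only [qaForm] <;> first | (exact absurd rfl h) | skip
  all_goals
    try split_ifs
    all_goals first | (norm_num; done) | (exfalso; apply h; congr)

theorem qaInner_abs (k l m : ℕ) (a b c : ℕ → ℤ) (x : QAIdx k l m → ℤ) :
    qaInner k l m a b c (fun v => |x v|) (fun v => |x v|) ≤ qaInner k l m a b c x x := by
  unfold qaInner
  refine Finset.sum_le_sum fun v _ => Finset.sum_le_sum fun w _ => ?_
  by_cases h : v = w
  · subst h; rw [abs_mul_abs_self]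
  · have := qaForm_off k l m a b c v w h
    have h2 := le_abs_self (x v * x w)
    rw [abs_mul] at h2
    nlinarith

theorem qaInner_eq (k l m : ℕ) (a b c : ℕ → ℤ) (x : QAIdx k l m → ℤ) :
    qaInner k l m a b c x x = 2 * x (Sum.inl ()) ^ 2
      + qaArm (x (Sum.inl ())) (qaL k a (fun i => x (Sum.inr (Sum.inl i))))
      + qaArm (x (Sum.inl ())) (qaL l b (fun i => x (Sum.inr (Sum.inr (Sum.inl i)))))
      + qaArm (x (Sum.inl ())) (qaL m c (fun i => x (Sum.inr (Sum.inr (Sum.inr i)))))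
      + ∑ v, (qaForm k l m a b c v v - 2) * x v := by
  rw [qaArm_L, qaArm_L, qaArm_L]
  simp only [qaInner, Fintype.sum_sum_type, qaForm, Finset.sum_add_distrib, mul_zero,
    Finset.sum_const_zero, Finset.univ_unique, Finset.sum_singleton, if_true]
  simp only [PUnit.default_eq_unit]
  ring

theorem qaForm_diag (k l m : ℕ) (a b c : ℕ → ℤ)
    (ha : ∀ i < k, 2 ≤ a i) (hb : ∀ i < l, 2 ≤ b i) (hc : ∀ i < m, 2 ≤ c i)
    (v : QAIdx k l m) : 2 ≤ qaForm k l m a b c v v := by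
  rcases v with v | v | v | v <;> simp [qaForm, ha, hb, hc]

theorem qa_main (k l m : ℕ) (hk : 1 ≤ k) (hl : 1 ≤ l)
    (a b c : ℕ → ℤ)
    (ha : ∀ i < k, 2 ≤ a i) (hb : ∀ i < l, 2 ≤ b i) (hc : ∀ i < m, 2 ≤ c i)
    (hcf : 1 / negCF a k + 1 / negCF b l < 1)
    (x : QAIdx k l m → ℤ) (hx : ∀ v, 0 ≤ x v) (w : QAIdx k l m) (hw : x w ≠ 0) :
    qaForm k l m a b c w w ≤ qaInner k l m a b c x x := by
  have hd := qaForm_diag k l m a b c ha hb hc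
  have hsum : (qaForm k l m a b c w w - 2) * x w ≤ ∑ v, (qaForm k l m a b c v v - 2) * x v :=
    Finset.single_le_sum (f := fun v => (qaForm k l m a b c v v - 2) * x v)
      (fun v _ => mul_nonneg (sub_nonneg.2 (hd v)) (hx v)) (Finset.mem_univ w)
  have hw1 : 1 ≤ x w := by have := hx w; omega
  have hw2 : qaForm k l m a b c w w - 2 ≤ (qaForm k l m a b c w w - 2) * x w :=
    le_mul_of_one_le_right (sub_nonneg.2 (hd w)) hw1
  rw [qaInner_eq]
  have oA := qaOK_L k a (fun i => x (Sum.inr (Sum.inl i))) ha (fun i => hx _)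
  have oB := qaOK_L l b (fun i => x (Sum.inr (Sum.inr (Sum.inl i)))) hb (fun i => hx _)
  have oC := qaOK_L m c (fun i => x (Sum.inr (Sum.inr (Sum.inr i)))) hc (fun i => hx _)
  have nA := qaNZ_L k a (fun i => x (Sum.inr (Sum.inl i)))
  have nB := qaNZ_L l b (fun i => x (Sum.inr (Sum.inr (Sum.inl i))))
  have nC := qaNZ_L m c (fun i => x (Sum.inr (Sum.inr (Sum.inr i))))
  have hr : qaR (qaL k a (fun i => x (Sum.inr (Sum.inl i)))) +
      qaR (qaL l b (fun i => x (Sum.inr (Sum.inr (Sum.inl i))))) < 1 := by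
    obtain ⟨k, rfl⟩ : ∃ k', k = k' + 1 := ⟨k - 1, by omega⟩
    obtain ⟨l, rfl⟩ : ∃ l', l = l' + 1 := ⟨l - 1, by omega⟩
    rw [qaR_L, qaR_L]; exact hcf
  generalize qaL k a (fun i => x (Sum.inr (Sum.inl i))) = A at *
  generalize qaL l b (fun i => x (Sum.inr (Sum.inr (Sum.inl i)))) = B at *
  generalize qaL m c (fun i => x (Sum.inr (Sum.inr (Sum.inr i)))) = C at *
  have hs := hx (Sum.inl ())
  have hC := qaArm_ge C oC (x (Sum.inl ()))
  have key : 2 ≤ qaG (x (Sum.inl ())) A B + (x (Sum.inl ()) ^ 2 - x (Sum.inl ()) +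
      qaArm (x (Sum.inl ())) C) := by
    by_cases h : qaNZ (x (Sum.inl ())) A B
    · have := qaG_ge _ _ A B rfl oA oB hs hr h
      linarith
    · simp only [qaNZ, not_or, not_not] at h
      obtain ⟨h0, h1, h2⟩ := h
      have hCn : ∃ p ∈ C, p.2 ≠ 0 := by
        rcases w with w | w | w | w
        · exact absurd h0 hw
        · exact absurd (nA w hw) h1
        · exact absurd (nB w hw) h2
        · exact nC w hw
      have := qaArm_two C oC hCn
      rw [h0, qaG, qaArm_allzero A h1, qaArm_allzero B h2]
      linarith
  unfold qaG at key
  linarith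

/-- In a quasi-alternating lattice: (i) every non-zero element has norm at least 2;
(ii) if `x = Σ c_v v` and `c_w ≠ 0` for some vertex `w`, then `‖x‖ ≥ ‖w‖`.
Here `x : QAIdx k l m → ℤ` records the coefficients of `x` in the vertex basis. -/
theorem stmt_6 (k l m : ℕ) (hk : 1 ≤ k) (hl : 1 ≤ l) (hm : 1 ≤ m)
    (a b c : ℕ → ℤ)
    (ha : ∀ i < k, 2 ≤ a i) (hb : ∀ i < l, 2 ≤ b i) (hc : ∀ i < m, 2 ≤ c i)
    (hcf : 1 / negCF a k + 1 / negCF b l < 1)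
    (x : QAIdx k l m → ℤ) :
    (x ≠ 0 → qaInner k l m a b c x x ≥ 2) ∧
    (∀ w : QAIdx k l m, x w ≠ 0 →
      qaInner k l m a b c x x ≥ qaForm k l m a b c w w) := by
  have main : ∀ w : QAIdx k l m, x w ≠ 0 →
      qaInner k l m a b c x x ≥ qaForm k l m a b c w w := fun w hw =>
    le_trans (qa_main k l m hk hl a b c ha hb hc hcf (fun v => |x v|) (fun v => abs_nonneg _) w
      (abs_ne_zero.2 hw)) (qaInner_abs k l m a b c x)
  refine ⟨fun hx => ?_, main⟩
  obtain ⟨w, hw⟩ := Function.ne_iff.1 hx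
  exact le_trans (qaForm_diag k l m a b c ha hb hc w) (main w hw)
end

section
/- Let L ⊆ ℤ^{s+t+1} be a p/q-changemaker lattice with q > 1. Then L contains no vector of norm one: there is no x ∈ L with x·x = 1. -/
/-- A nondecreasing tuple `(σ_1, …, σ_t)` of positive integers (here `σ i` for `i < t`
represents `σ_{i+1}`) satisfies the changemaker condition if every integer `n` with
`1 ≤ n ≤ σ_1 + … + σ_t` is a sum of the `σ_i` over some subset of indices. -/
def Changemaker (t : ℕ) (σ : ℕ → ℤ) : Prop :=
  ∀ n : ℤ, 1 ≤ n → n ≤ ∑ i ∈ Finset.range t, σ i →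
    ∃ A : Finset ℕ, A ⊆ Finset.range t ∧ n = ∑ i ∈ A, σ i

/-- The ambient lattice `ℤ^{s+t+1}` with orthonormal basis `f_0, …, f_s`
(coordinates `Sum.inl i`) and `e_1, …, e_t` (coordinate `Sum.inr i` represents
`e_{i+1}`), with its standard inner product. -/
def cmInner {s t : ℕ} (x y : Fin (s + 1) ⊕ Fin t → ℤ) : ℤ :=
  ∑ j, x j * y j

/-- The defining vectors of a changemaker lattice:
`w_0 = f_0 + σ_1 e_1 + … + σ_t e_t` and, for `1 ≤ k ≤ l`,
`w_k = −f_{α_{k−1}} + f_{α_{k−1}+1} + … + f_{α_k}`. -/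
def cmW (s t : ℕ) (σ : ℕ → ℤ) (α : ℕ → ℕ) : ℕ → Fin (s + 1) ⊕ Fin t → ℤ
  | 0 => fun j => match j with
      | Sum.inl i => if i.val = 0 then 1 else 0
      | Sum.inr i => σ i.val
  | k + 1 => fun j => match j with
      | Sum.inl i =>
          if i.val = α k then -1
          else if α k < i.val ∧ i.val ≤ α (k + 1) then 1 else 0
      | Sum.inr _ => 0

/-- The `p/q`-changemaker lattice `L = ⟨w_0, …, w_l⟩^⊥ ⊆ ℤ^{s+t+1}`. -/
def cmLattice (s t l : ℕ) (σ : ℕ → ℤ) (α : ℕ → ℕ) : Set (Fin (s + 1) ⊕ Fin t → ℤ) :=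
  {x | ∀ k ≤ l, cmInner x (cmW s t σ α k) = 0}

/-- The vectors `μ_0 = f_0 + … + f_{β_1}` and, for `k ≥ 1`,
`μ_k = −f_{β_k} + f_{β_k+1} + … + f_{β_{k+1}}`. -/
def cmMu (s t : ℕ) (β : ℕ → ℕ) : ℕ → Fin (s + 1) ⊕ Fin t → ℤ
  | 0 => fun j => match j with
      | Sum.inl i => if i.val ≤ β 1 then 1 else 0
      | Sum.inr _ => 0
  | k + 1 => fun j => match j with
      | Sum.inl i =>
          if i.val = β (k + 1) then -1
          else if β (k + 1) < i.val ∧ i.val ≤ β (k + 2) then 1 else 0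
      | Sum.inr _ => 0

/-- The standard basis vectors `ν_1, …, ν_t` (here `cmNu … k` for `k < t` represents
`ν_{k+1}`, with `e`-indices shifted down by one):  if `σ_{k+1}` is tight then
`ν_{k+1} = −e_{k+1} + e_k + … + e_1 + μ_0`, and otherwise
`ν_{k+1} = −e_{k+1} + Σ_{i ∈ A_{k+1}} e_i`, where `A` records the lexicographically
maximal subsets. -/
def cmNu (s t : ℕ) (σ : ℕ → ℤ) (β : ℕ → ℕ) (A : ℕ → Finset ℕ) (k : ℕ) :
    Fin (s + 1) ⊕ Fin t → ℤ :=
  if σ k = 1 + ∑ i ∈ Finset.range k, σ i then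
    fun j => match j with
      | Sum.inl i => if i.val ≤ β 1 then 1 else 0
      | Sum.inr i => if i.val = k then -1 else if i.val < k then 1 else 0
  else
    fun j => match j with
      | Sum.inl _ => 0
      | Sum.inr i => if i.val = k then -1 else if i.val ∈ A k then 1 else 0

/-- A `p/q`-changemaker lattice with `q > 1` contains no vector of norm one. -/
theorem stmt_11
    (p q : ℕ) (hp : 0 < p) (hq : 1 < q) (hpq : Nat.Coprime p q)
    (l : ℕ) (hl : 1 ≤ l)
    (a : ℕ → ℕ) (ha0 : 1 ≤ a 0) (ha : ∀ i, 1 ≤ i → i ≤ l → 2 ≤ a i)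
    (hcf : negCF (fun i => (a i : ℤ)) (l + 1) = (p : ℚ) / q)
    (s : ℕ) (hs : s = ∑ i ∈ Finset.Icc 1 l, (a i - 1))
    (α : ℕ → ℕ) (hα : ∀ k, α k = ∑ i ∈ Finset.Icc 1 k, (a i - 1))
    (t : ℕ) (ht : 1 ≤ t)
    (σ : ℕ → ℤ) (hσpos : ∀ i < t, 0 < σ i)
    (hσmono : ∀ i j, i ≤ j → j < t → σ i ≤ σ j)
    (hσcm : Changemaker t σ)
    (hσnorm : 1 + ∑ i ∈ Finset.range t, σ i ^ 2 = (a 0 : ℤ))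
    :
    ¬ ∃ x ∈ cmLattice s t l σ α, cmInner x x = 1 := by
  rintro ⟨x, hx, hn⟩
  have hW : ∀ j : Fin (s + 1) ⊕ Fin t, ∃ k ≤ l, cmW s t σ α k j ≠ 0 := by
    rintro (i | i)
    · by_cases hi : i.val = 0
      · exact ⟨0, Nat.zero_le _, by simp [cmW, hi]⟩
      · have hex : ∃ k, i.val ≤ α k := ⟨l, by
          have h1 := i.isLt
          have h2 := hα l
          omega⟩
        have hle : Nat.find hex ≤ l := Nat.find_min' hex (by
          have h1 := i.isLt
          have h2 := hα l
          omega)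
        have hspec := Nat.find_spec hex
        have hmin := fun m => @Nat.find_min _ _ hex m
        generalize Nat.find hex = k at hle hspec hmin
        cases k with
        | zero =>
          have h0 := hα 0
          simp at h0
          omega
        | succ m =>
          refine ⟨m + 1, hle, ?_⟩
          have h3 := hmin m (Nat.lt_succ_self m)
          have h4 : α m < i.val := by omega
          have h5 : i.val ≠ α m := by omega
          simp [cmW, h4, h5, hspec]
    · exact ⟨0, Nat.zero_le _, by simpa [cmW] using (hσpos i.val i.isLt).ne'⟩
  unfold cmInner at hn
  obtain ⟨j, -, hj⟩ := Finset.exists_ne_zero_of_sum_ne_zero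
    (s := Finset.univ) (f := fun j => x j * x j) (by rw [hn]; norm_num)
  have hxj : x j ≠ 0 := by
    intro h
    simp [h] at hj
  have hz : ∀ i, i ≠ j → x i = 0 := by
    intro i hij
    have h1 : ∑ m ∈ {i, j}, x m * x m ≤ ∑ m, x m * x m :=
      Finset.sum_le_sum_of_subset_of_nonneg (Finset.subset_univ _)
        (fun m _ _ => mul_self_nonneg _)
    rw [Finset.sum_pair hij, hn] at h1
    have h2 : 0 < x j * x j := mul_self_pos.mpr hxj
    have h3 := mul_self_nonneg (x i)
    have h4 : x i * x i = 0 := by omega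
    exact mul_self_eq_zero.mp h4
  obtain ⟨k, hk, hne⟩ := hW j
  have h := hx k hk
  unfold cmInner at h
  rw [Finset.sum_eq_single j (fun i _ hij => by rw [hz i hij, zero_mul])
    (fun h => absurd (Finset.mem_univ j) h)] at h
  exact (mul_ne_zero hxj hne) h
end

section
/- Let L ⊆ ℤ^{s+t+1} be a p/q-changemaker lattice with q > 1, and let S = {ν_1, …, ν_t, μ_1, …, μ_{m−1}} be its standard basis. Then S is a ℤ-basis of L: every element of L is a unique integer linear combination of the elements of S. -/
def cmSub (s t l : ℕ) (σ : ℕ → ℤ) (α : ℕ → ℕ) : Submodule ℤ (Fin (s + 1) ⊕ Fin t → ℤ) where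
  carrier := cmLattice s t l σ α
  zero_mem' := by
    intro k _
    simp [cmInner]
  add_mem' := by
    intro x y hx hy k hk
    have h1 := hx k hk
    have h2 := hy k hk
    simp only [cmInner, Pi.add_apply, add_mul, Finset.sum_add_distrib] at *
    rw [h1, h2, add_zero]
  smul_mem' := by
    intro c x hx k hk
    have h1 := hx k hk
    simp only [cmInner, Pi.smul_apply, smul_eq_mul, mul_assoc, ← Finset.mul_sum] at *
    rw [h1, mul_zero]

lemma tri_aux {n : ℕ} (M : Matrix (Fin n) (Fin n) ℤ) (hu : IsUnit M.det) (x : Fin n → ℤ) :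
    ∃! c : Fin n → ℤ, ∀ i, x i = ∑ k, c k * M k i := by
  refine ⟨Matrix.vecMul x M⁻¹, ?_, ?_⟩
  · intro i
    have : Matrix.vecMul (Matrix.vecMul x M⁻¹) M = x := by
      rw [Matrix.vecMul_vecMul, Matrix.nonsing_inv_mul _ hu, Matrix.vecMul_one]
    exact (congrFun this i).symm
  · intro c hc
    have h : x = Matrix.vecMul c M := funext hc
    rw [h, Matrix.vecMul_vecMul, Matrix.mul_nonsing_inv _ hu, Matrix.vecMul_one]

lemma tri_lower {n : ℕ} (M : Matrix (Fin n) (Fin n) ℤ) (h1 : ∀ i, M i i = -1)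
    (h0 : ∀ i j, i < j → M i j = 0) : IsUnit M.det := by
  rw [Matrix.det_of_lowerTriangular M (fun i j h => h0 i j h)]
  simp only [h1, Finset.prod_const]
  exact (isUnit_one.neg).pow _

lemma tri_upper {n : ℕ} (M : Matrix (Fin n) (Fin n) ℤ) (h1 : ∀ i, M i i = -1)
    (h0 : ∀ i j, j < i → M i j = 0) : IsUnit M.det := by
  rw [Matrix.det_of_upperTriangular (M := M) (fun i j h => h0 i j h)]
  simp only [h1, Finset.prod_const]
  exact (isUnit_one.neg).pow _

/-- Inner product with `w_{k+1}` as an interval sum. -/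
lemma inner_succ (s t : ℕ) (σ : ℕ → ℤ) (α : ℕ → ℕ) (k : ℕ) (h1 : α k < α (k + 1))
    (h2 : α (k + 1) ≤ s) (y : Fin (s + 1) ⊕ Fin t → ℤ) (g : ℕ → ℤ)
    (hg : ∀ i : Fin (s + 1), y (Sum.inl i) = g i.val) :
    cmInner y (cmW s t σ α (k + 1)) = (∑ j ∈ Finset.Ioc (α k) (α (k + 1)), g j) - g (α k) := by
  simp only [cmInner, Fintype.sum_sum_type, cmW, hg, mul_zero, Finset.sum_const_zero, add_zero]
  rw [Fin.sum_univ_eq_sum_range (fun i => g i * (if i = α k then -1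
          else if α k < i ∧ i ≤ α (k + 1) then 1 else 0)) (s + 1)]
  have : ∀ i, g i * (if i = α k then (-1 : ℤ) else if α k < i ∧ i ≤ α (k + 1) then 1 else 0)
      = (if i ∈ Finset.Ioc (α k) (α (k + 1)) then g i else 0) - (if i = α k then g i else 0) := by
    intro i
    simp only [Finset.mem_Ioc]
    split_ifs <;> first | omega | simp
  simp only [this, Finset.sum_sub_distrib]
  rw [Finset.sum_ite_mem, Finset.sum_ite_eq']
  have h3 : Finset.range (s + 1) ∩ Finset.Ioc (α k) (α (k + 1)) = Finset.Ioc (α k) (α (k + 1)) := by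
    ext i
    simp only [Finset.mem_inter, Finset.mem_range, Finset.mem_Ioc]
    omega
  rw [h3, if_pos (by simp; omega)]

lemma inner_zero (s t : ℕ) (σ : ℕ → ℤ) (α : ℕ → ℕ) (y : Fin (s + 1) ⊕ Fin t → ℤ) :
    cmInner y (cmW s t σ α 0) = y (Sum.inl 0) + ∑ i : Fin t, y (Sum.inr i) * σ i := by
  simp only [cmInner, Fintype.sum_sum_type, cmW]
  congr 1
  rw [Finset.sum_eq_single 0]
  · simp
  · intro b _ hb
    have : b.val ≠ 0 := fun h => hb (Fin.ext h)
    simp [this]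
  · simp

lemma sum_tele (g F : ℕ → ℤ) (h : ∀ n, F (n + 1) - F n = g (n + 1)) (b c : ℕ) (hbc : b ≤ c) :
    ∑ j ∈ Finset.Ioc b c, g j = F c - F b := by
  induction c, hbc using Nat.le_induction with
  | base => simp
  | succ n hn ih =>
    rw [← Finset.insert_Ioc_right_eq_Ioc_add_one hn, Finset.sum_insert (by simp), ih, ← h]
    ring

/-- The standard basis `S = {ν_1, …, ν_t, μ_1, …, μ_{m−1}}` of a `p/q`-changemaker
lattice with `q > 1` is a `ℤ`-basis: its elements lie in `L` and every element of
`L` is a unique integer linear combination of them. -/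
theorem stmt_13
    (p q : ℕ) (hp : 0 < p) (hq : 1 < q) (hpq : Nat.Coprime p q)
    (l : ℕ) (hl : 1 ≤ l)
    (a : ℕ → ℕ) (ha0 : 1 ≤ a 0) (ha : ∀ i, 1 ≤ i → i ≤ l → 2 ≤ a i)
    (hcf : negCF (fun i => (a i : ℤ)) (l + 1) = (p : ℚ) / q)
    (s : ℕ) (hs : s = ∑ i ∈ Finset.Icc 1 l, (a i - 1))
    (α : ℕ → ℕ) (hα : ∀ k, α k = ∑ i ∈ Finset.Icc 1 k, (a i - 1))
    (t : ℕ) (ht : 1 ≤ t)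
    (σ : ℕ → ℤ) (hσpos : ∀ i < t, 0 < σ i)
    (hσmono : ∀ i j, i ≤ j → j < t → σ i ≤ σ j)
    (hσcm : Changemaker t σ)
    (hσnorm : 1 + ∑ i ∈ Finset.range t, σ i ^ 2 = (a 0 : ℤ))
    (m : ℕ) (β : ℕ → ℕ)
    (hβ0 : β 0 = 0) (hβm : β m = s)
    (hβmono : ∀ i j, i < j → j ≤ m → β i < β j)
    (hβmem : ∀ n, (n ≤ s ∧ ∀ k, 1 ≤ k → k ≤ l - 1 → n ≠ α k) ↔ ∃ i ≤ m, β i = n)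
    (A : ℕ → Finset ℕ)
    (hA : ∀ k < t, σ k ≠ 1 + ∑ i ∈ Finset.range k, σ i →
      A k ⊆ Finset.range k ∧ σ k = (∑ i ∈ A k, σ i) ∧
      ∀ B ⊆ Finset.range k, σ k = (∑ i ∈ B, σ i) → B ≠ A k →
        ∃ j ∈ A k, j ∉ B ∧ ∀ j' ∈ B, j' ∉ A k → j' < j)
    :
    (∀ k < t, cmNu s t σ β A k ∈ cmLattice s t l σ α) ∧
    (∀ k, 1 ≤ k → k ≤ m - 1 → cmMu s t β k ∈ cmLattice s t l σ α) ∧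
    (∀ x ∈ cmLattice s t l σ α,
      ∃! cd : (Fin t → ℤ) × (Fin (m - 1) → ℤ),
        x = (∑ k : Fin t, cd.1 k • cmNu s t σ β A k.val)
          + ∑ k : Fin (m - 1), cd.2 k • cmMu s t β (k.val + 1)) := by
  have hsl : s = α l := by rw [hs, hα]
  have hα0 : α 0 = 0 := by rw [hα]; simp
  have hαs : ∀ k < l, α k < α (k + 1) := by
    intro k hk
    rw [hα (k + 1), hα k, Finset.sum_Icc_succ_top (by omega)]
    have := ha (k + 1) (by omega) (by omega)
    omega
  have hαm : ∀ i j, i ≤ j → j ≤ l → α i ≤ α j := by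
    intro i j hij
    induction j, hij using Nat.le_induction with
    | base => intro _; exact le_rfl
    | succ n hn ih =>
      intro h
      have := hαs n (by omega)
      have := ih (by omega)
      omega
  have hαm' : ∀ i j, i < j → j ≤ l → α i < α j := by
    intro i j hij hj
    have := hαs i (by omega)
    have := hαm (i + 1) j hij hj
    omega
  have hs1 : 0 < s := by
    have := hαm' 0 l (by omega) le_rfl
    omega
  have hm : 1 ≤ m := by
    rcases Nat.eq_zero_or_pos m with h | h
    · subst h; omega
    · exact h
  have hβle : ∀ i ≤ m, β i ≤ s := by
    intro i hi
    rcases Nat.lt_or_ge i m with h | h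
    · have := hβmono i m h le_rfl
      omega
    · have : i = m := by omega
      subst this; omega
  -- a β is not an interior α
  have hβα : ∀ i ≤ m, ∀ k, 1 ≤ k → k < l → β i ≠ α k := by
    intro i hi k hk hkl
    exact ((hβmem (β i)).2 ⟨i, hi, rfl⟩).2 k hk (by omega)
  -- an element strictly inside a block is a β
  have hblock : ∀ k < l, ∀ n, α k < n → n < α (k + 1) → ∃ i ≤ m, β i = n := by
    intro k hk n h1 h2
    rw [← hβmem]
    have := hαm (k + 1) l (by omega) le_rfl
    refine ⟨by omega, ?_⟩
    intro j hj hjl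
    rcases Nat.lt_or_ge k j with h | h
    · have := hαm (k + 1) j h (by omega)
      omega
    · have := hαm j k h (by omega)
      omega
  have hgap : ∀ k < m, ∀ i ≤ m, β k < β i → β (k + 1) ≤ β i := by
    intro k hk i hi h
    by_contra hc
    rcases Nat.lt_trichotomy i (k + 1) with h' | h' | h'
    · rcases Nat.lt_or_ge i k with h'' | h''
      · have := hβmono i k h'' (by omega)
        omega
      · have : i = k := by omega
        subst this; omega
    · subst h'; omega
    · have := hβmono (k + 1) i h' hi
      omega
  -- block sums for tight ν
  have hμ0 : ∀ y : Fin (s + 1) ⊕ Fin t → ℤ,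
      (∀ i : Fin (s + 1), y (Sum.inl i) = if i.val ≤ β 1 then 1 else 0) →
      ∀ k < l, cmInner y (cmW s t σ α (k + 1)) = 0 := by
    intro y hy k hk
    have hk1 := hαs k hk
    have hk2 := hαm (k + 1) l (by omega) le_rfl
    rw [inner_succ s t σ α k hk1 (by omega) y (fun n => if n ≤ β 1 then 1 else 0) hy]
    rw [sum_tele _ (fun n => if n ≤ β 1 then (n : ℤ) else β 1) ?_ _ _ hk1.le]
    · have h01 := hβmono 0 1 (by omega) hm
      have hne : β 1 ≠ α k := by
        rcases Nat.eq_zero_or_pos k with h | h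
        · subst h; omega
        · exact hβα 1 hm k h hk
      have hstep : α k < β 1 → α (k + 1) = α k + 1 ∨ β 1 ≤ α k + 1 := by
        intro h
        by_contra hc
        push Not at hc
        obtain ⟨i, hi, hi'⟩ := hblock k hk (α k + 1) (by omega) (by omega)
        have := hgap 0 (by omega) i hi (by omega)
        simp at this
        omega
      split_ifs <;> omega
    · intro n
      split_ifs <;> push_cast <;> omega
  have hμ : ∀ r, 1 ≤ r → r < m → ∀ k < l, cmInner (cmMu s t β r) (cmW s t σ α (k + 1)) = 0 := by
    intro r hr hrm k hk
    obtain ⟨r, rfl⟩ : ∃ r', r = r' + 1 := ⟨r - 1, by omega⟩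
    have hk1 := hαs k hk
    have hk2 := hαm (k + 1) l (by omega) le_rfl
    have hb := hβmono (r + 1) (r + 2) (by omega) (by omega)
    have hb0 := hβmono 0 (r + 1) (by omega) (by omega)
    have hbs := hβmono (r + 1) m hrm le_rfl
    rw [inner_succ s t σ α k hk1 (by omega) _ (fun n => if n = β (r + 1) then -1
          else if β (r + 1) < n ∧ n ≤ β (r + 2) then 1 else 0) (fun i => rfl)]
    rw [sum_tele _ (fun n => if n < β (r + 1) then (0 : ℤ) else
      if n ≤ β (r + 2) then n - β (r + 1) - 1 else β (r + 2) - β (r + 1) - 1) ?_ _ _ hk1.le]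
    · have hne1 : β (r + 1) ≠ α k := by
        rcases Nat.eq_zero_or_pos k with h | h
        · subst h; omega
        · exact hβα _ (by omega) k h hk
      have hne2 : β (r + 2) ≠ α k := by
        rcases Nat.eq_zero_or_pos k with h | h
        · subst h; omega
        · exact hβα _ (by omega) k h hk
      have hne3 : β (r + 1) ≠ α (k + 1) := by
        rcases Nat.lt_or_ge (k + 1) l with h | h
        · exact hβα _ (by omega) _ (by omega) h
        · have : k + 1 = l := by omega
          rw [this]; omega
      have key : ∀ n, α k < n → n < α (k + 1) → β (r + 1) < n → β (r + 2) ≤ n := by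
        intro n h1 h2 h3
        obtain ⟨i, hi, rfl⟩ := hblock k hk n h1 h2
        exact hgap (r + 1) hrm i hi h3
      have key1 := key (α k + 1)
      have key2 := key (β (r + 1) + 1)
      split_ifs <;> omega
    · intro n
      split_ifs <;> push_cast <;> omega
  have hνmem : ∀ k < t, cmNu s t σ β A k ∈ cmLattice s t l σ α := by
    intro k hk j hj
    rcases Nat.eq_zero_or_pos j with h | h
    · subst h
      rw [inner_zero]
      by_cases htt : σ k = 1 + ∑ i ∈ Finset.range k, σ i
      · simp only [cmNu, if_pos htt]
        rw [Fin.sum_univ_eq_sum_range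
          (fun i => (if i = k then (-1 : ℤ) else if i < k then 1 else 0) * σ i) t]
        have : ∀ i, (if i = k then (-1 : ℤ) else if i < k then 1 else 0) * σ i
          = (if i ∈ Finset.range k then σ i else 0) - (if i = k then σ i else 0) := by
          intro i
          simp only [Finset.mem_range]
          split_ifs <;> first | omega | simp
        simp only [this, Finset.sum_sub_distrib]
        rw [Finset.sum_ite_mem, Finset.sum_ite_eq', if_pos (Finset.mem_range.2 hk),
          Finset.inter_eq_right.2 (by simpa using hk.le)]
        rw [if_pos (by simp)]
        linarith
      · obtain ⟨hA1, hA2, -⟩ := hA k hk htt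
        simp only [cmNu, if_neg htt]
        rw [Fin.sum_univ_eq_sum_range
          (fun i => (if i = k then (-1 : ℤ) else if i ∈ A k then 1 else 0) * σ i) t]
        have : ∀ i, (if i = k then (-1 : ℤ) else if i ∈ A k then 1 else 0) * σ i
          = (if i ∈ A k then σ i else 0) - (if i = k then σ i else 0) := by
          intro i
          have : i ∈ A k → i < k := fun h => by simpa using hA1 h
          by_cases hik : i = k
          · have hiA : i ∉ A k := fun h => absurd (this h) (by omega)
            simp [hik, hik ▸ hiA]
          · simp [hik]
        simp only [this, Finset.sum_sub_distrib]
        rw [Finset.sum_ite_mem, Finset.sum_ite_eq', if_pos (Finset.mem_range.2 hk),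
          Finset.inter_eq_right.2 (hA1.trans (by simpa using hk.le))]
        linarith
    · obtain ⟨j, rfl⟩ : ∃ r', j = r' + 1 := ⟨j - 1, by omega⟩
      by_cases htt : σ k = 1 + ∑ i ∈ Finset.range k, σ i
      · apply hμ0 _ _ j (by omega)
        intro i
        simp only [cmNu, if_pos htt]
      · simp [cmInner, cmNu, if_neg htt, cmW]
  have hμmem : ∀ k, 1 ≤ k → k ≤ m - 1 → cmMu s t β k ∈ cmLattice s t l σ α := by
    intro k hk hkm j hj
    rcases Nat.eq_zero_or_pos j with h | h
    · subst h
      rw [inner_zero]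
      obtain ⟨k, rfl⟩ : ∃ r', k = r' + 1 := ⟨k - 1, by omega⟩
      have hb0 := hβmono 0 (k + 1) (by omega) (by omega)
      have h1 : (0 : ℕ) ≠ β (k + 1) := by omega
      simp [cmMu, h1]
    · obtain ⟨j, rfl⟩ : ∃ r', j = r' + 1 := ⟨j - 1, by omega⟩
      exact hμ k hk (by omega) j (by omega)
  -- vanishing
  have hZ : ∀ y ∈ cmLattice s t l σ α, (∀ i, y (Sum.inr i) = 0) →
      (∀ i, 1 ≤ i → i < m → ∀ h : β i < s + 1, y (Sum.inl ⟨β i, h⟩) = 0) → y = 0 := by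
    intro y hy he hb
    have hy0 := hy 0 (by omega)
    rw [inner_zero] at hy0
    simp only [he, zero_mul, Finset.sum_const_zero, add_zero] at hy0
    set g : ℕ → ℤ := fun n => if h : n < s + 1 then y (Sum.inl ⟨n, h⟩) else 0 with hg
    have hgy : ∀ i : Fin (s + 1), y (Sum.inl i) = g i.val := by
      intro i
      simp only [hg]
      rw [dif_pos i.2]
    have hgβ : ∀ i < m, g (β i) = 0 := by
      intro i hi
      have := hβle i hi.le
      rcases Nat.eq_zero_or_pos i with h | h
      · subst h
        rw [hβ0, ← hy0, hgy]; rfl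
      · simp only [hg]
        rw [dif_pos (by omega)]
        exact hb i h hi _
    have hin : ∀ k < l, ∀ n, α k < n → n < α (k + 1) → g n = 0 := by
      intro k hk n h1 h2
      obtain ⟨i, hi, rfl⟩ := hblock k hk n h1 h2
      have hk2 := hαm (k + 1) l (by omega) le_rfl
      apply hgβ
      rcases Nat.lt_or_ge i m with h | h
      · exact h
      · have : i = m := by omega
        subst this; omega
    have hgα : ∀ k ≤ l, g (α k) = 0 := by
      intro k
      induction k with
      | zero =>
        intro _
        rw [hα0, ← hβ0]
        exact hgβ 0 (by omega)
      | succ k ih =>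
        intro hk
        have hk1 := hαs k (by omega)
        have hk2 := hαm (k + 1) l (by omega) le_rfl
        have h := hy (k + 1) hk
        rw [inner_succ s t σ α k hk1 (by omega) y g hgy, ih (by omega),
          Finset.sum_eq_single (α (k + 1))] at h
        · linarith
        · intro b hb hne
          rw [Finset.mem_Ioc] at hb
          exact hin k (by omega) b hb.1 (by omega)
        · intro h
          simp at h
          omega
    have hall : ∀ k ≤ l, ∀ n ≤ α k, g n = 0 := by
      intro k
      induction k with
      | zero =>
        intro _ n hn
        have : n = α 0 := by omega
        rw [this]; exact hgα 0 (by omega)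
      | succ k ih =>
        intro hk n hn
        rcases Nat.lt_or_ge (α k) n with h | h
        · rcases Nat.lt_or_ge n (α (k + 1)) with h' | h'
          · exact hin k (by omega) n h h'
          · have : n = α (k + 1) := by omega
            rw [this]; exact hgα _ hk
        · exact ih (by omega) n h
    funext j
    rcases j with i | i
    · rw [hgy]
      have := i.2
      exact hall l le_rfl _ (by omega)
    · exact he i
  refine ⟨hνmem, hμmem, ?_⟩
  intro x hx
  have hβlt : ∀ i : Fin (m - 1), β (i.val + 1) < s + 1 := by
    intro i
    have := hβle (i.val + 1) (by omega)
    omega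
  have hT1 := tri_aux (Matrix.of fun k i : Fin t => cmNu s t σ β A k.val (Sum.inr i))
    (tri_lower _ (by
      intro i
      simp only [Matrix.of_apply, cmNu]
      split_ifs <;> simp) (by
      intro i j hij
      have hij' : i.val < j.val := hij
      simp only [Matrix.of_apply, cmNu]
      split_ifs with htt
      · simp only
        rw [if_neg (by omega), if_neg (by omega)]
      · simp only
        have : j.val ∉ A i.val := fun h => by
          have := (hA i i.2 htt).1 h
          simp at this
          omega
        rw [if_neg (by omega), if_neg this]))
  have hT2 := tri_aux (Matrix.of fun k i : Fin (m - 1) =>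
      cmMu s t β (k.val + 1) (Sum.inl ⟨β (i.val + 1), hβlt i⟩))
    (tri_upper _ (by
      intro i
      simp [cmMu]) (by
      intro i j hij
      have hij' : j.val < i.val := hij
      have := hβmono (j.val + 1) (i.val + 1) (by omega) (by omega)
      simp only [Matrix.of_apply, cmMu]
      rw [if_neg (by omega), if_neg (by omega)]))
  have hμe : ∀ k i, cmMu s t β (k + 1) (Sum.inr i) = 0 := fun k i => rfl
  obtain ⟨c, hc, hcu⟩ := hT1 (fun i => x (Sum.inr i))
  obtain ⟨d, hd, hdu⟩ := hT2 (fun i => (x - ∑ k : Fin t, c k • cmNu s t σ β A k.val)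
    (Sum.inl ⟨β (i.val + 1), hβlt i⟩))
  refine ⟨(c, d), ?_, ?_⟩
  · have h0 := hZ (x - ((∑ k : Fin t, c k • cmNu s t σ β A k.val)
          + ∑ k : Fin (m - 1), d k • cmMu s t β (k.val + 1))) ?_ ?_ ?_
    · exact sub_eq_zero.1 h0
    · refine (cmSub s t l σ α).sub_mem hx ((cmSub s t l σ α).add_mem ?_ ?_)
      · exact Submodule.sum_mem _ fun k _ => Submodule.smul_mem _ _ (hνmem k k.2)
      · exact Submodule.sum_mem _ fun k _ => Submodule.smul_mem _ _
          (hμmem (k + 1) (by omega) (by omega))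
    · intro i
      have := hc i
      simp only [Matrix.of_apply] at this
      simp [hμe, this]
    · intro i hi him h
      obtain ⟨i, rfl⟩ : ∃ r', i = r' + 1 := ⟨i - 1, by omega⟩
      have := hd ⟨i, by omega⟩
      simp only [Matrix.of_apply] at this
      rw [← sub_sub, Pi.sub_apply, this]
      simp
  · rintro ⟨c', d'⟩ h
    simp only at h
    have hc' : c' = c := by
      apply hcu
      intro i
      simp only [Matrix.of_apply]
      rw [h]
      simp [hμe]
    subst hc'
    have hd' : d' = d := by
      apply hdu
      intro i
      simp only [Matrix.of_apply]
      rw [h]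
      simp
    rw [hd']
end

section
/- Let L ⊆ ℤ^{s+t+1} be a p/q-changemaker lattice with q > 1. Then every element v of the standard basis S = {ν_1, …, ν_t, μ_1, …, μ_{m−1}} is irreducible: whenever v = x + y with x, y ∈ L and x·y ≥ 0, then x = 0 or y = 0. -/
theorem cm_two {s t l : ℕ} {σ : ℕ → ℤ} {α : ℕ → ℕ} {z : Fin (s + 1) ⊕ Fin t → ℤ}
    (hz : z ∈ cmLattice s t l σ α) (j i : ℕ) (hj : j < l) (h1 : α j ≤ i) (h2 : i < α (j + 1))
    (his : i + 1 < s + 1)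
    (h0 : ∀ n (hn : n < s + 1), (α j ≤ n ∧ n < i) ∨ (i + 1 < n ∧ n ≤ α (j + 1)) →
      z (Sum.inl ⟨n, hn⟩) = 0)
    (hi : z (Sum.inl ⟨i, by omega⟩) = 0 ) :
    z (Sum.inl ⟨i + 1, his⟩) = 0 := by
  have h := hz (j + 1) (by omega)
  unfold cmInner at h
  rw [Fintype.sum_sum_type] at h
  simp only [cmW, mul_zero, Finset.sum_const_zero, add_zero] at h
  rw [Finset.sum_eq_single (⟨i + 1, his⟩ : Fin (s + 1))] at h
  · have e1 : ¬ (i + 1 = α j) := by omega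
    have e2 : α j < i + 1 ∧ i + 1 ≤ α (j + 1) := by omega
    simpa [e1, e2] using h
  · rintro ⟨n, hn⟩ - hne
    have hne' : n ≠ i + 1 := fun h => hne (by simp [h])
    by_cases hni : n = i
    · subst hni; rw [hi]; simp
    by_cases hc : (α j ≤ n ∧ n < i) ∨ (i + 1 < n ∧ n ≤ α (j + 1))
    · rw [h0 n hn hc]; simp
    · have e1 : ¬ (n = α j) := by omega
      have e2 : ¬ (α j < n ∧ n ≤ α (j + 1)) := by omega
      simp [e1, e2]
  · intro h; exact absurd (Finset.mem_univ _) h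

/-- propagation of zeros from `b` up to the next element `c` of `M`. -/
theorem cm_chain {s t l : ℕ} {σ : ℕ → ℤ} {α : ℕ → ℕ} {z : Fin (s + 1) ⊕ Fin t → ℤ}
    (hz : z ∈ cmLattice s t l σ α) (hl : 1 ≤ l) (hα0 : α 0 = 0) (hαl : α l = s)
    (hαm : ∀ i j, i < j → j ≤ l → α i < α j)
    (b c : ℕ) (hbc : b < c) (hcs : c ≤ s)
    (hM : ∀ n, b < n → n < c → ∃ j, 1 ≤ j ∧ j ≤ l - 1 ∧ n = α j)
    (hlow : ∀ n (hn : n < s + 1), n < b → z (Sum.inl ⟨n, hn⟩) = 0)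
    (hhigh : ∀ n (hn : n < s + 1), c < n → z (Sum.inl ⟨n, hn⟩) = 0)
    (hb : z (Sum.inl ⟨b, by omega⟩) = 0) :
    ∀ n (hn : n < s + 1), z (Sum.inl ⟨n, hn⟩) = 0 := by
  have hle : ∀ i j, i ≤ j → j ≤ l → α i ≤ α j := by
    intro i j hij hj
    rcases Nat.eq_or_lt_of_le hij with h | h
    · rw [h]
    · exact (hαm i j h hj).le
  intro n
  induction n using Nat.strong_induction_on with
  | _ n ih =>
    intro hn
    rcases lt_trichotomy n b with h | h | h
    · exact hlow n hn h
    · subst h; exact hb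
    by_cases hnc : c < n
    · exact hhigh n hn hnc
    obtain ⟨i, rfl⟩ : ∃ i, n = i + 1 := ⟨n - 1, by omega⟩
    -- find the block
    have hex : ∃ j, i < α j := ⟨l, by omega⟩
    classical
    obtain ⟨j0, hj0, hmin⟩ : ∃ j0, i < α j0 ∧ ∀ j < j0, ¬ i < α j :=
      ⟨Nat.find hex, Nat.find_spec hex, fun j hj => Nat.find_min hex hj⟩
    have hj0l : j0 ≤ l := by
      by_contra hcon
      exact hmin l (by omega) (by omega)
    obtain ⟨j, rfl⟩ : ∃ j, j0 = j + 1 := ⟨j0 - 1, by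
      rcases Nat.eq_zero_or_pos j0 with h | h
      · subst h; omega
      · omega⟩
    have hj1 := hmin j (by omega)
    refine cm_two hz j i (by omega) (by omega) hj0 hn ?_ (ih i (by omega) (by omega))
    rintro n' hn' (⟨_, h2⟩ | ⟨h1, h2⟩)
    · exact ih n' (by omega) hn'
    · apply hhigh
      by_contra hcon
      obtain ⟨j', hj1', hj2', hj3⟩ := hM (i + 1) (by omega) (by omega)
      have : j < j' := by
        by_contra hh
        have := hle j' j (by omega) (by omega)
        omega
      have := hle (j + 1) j' (by omega) (by omega)
      omega

theorem cm_key
    (l : ℕ) (hl : 1 ≤ l) (s t : ℕ) (σ : ℕ → ℤ) (α β : ℕ → ℕ) (hα0 : α 0 = 0) (hαl : α l = s)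
    (hαm : ∀ i j, i < j → j ≤ l → α i < α j)
    (hσpos : ∀ i < t, 0 < σ i)
    (m : ℕ)
    (hβ0 : β 0 = 0) (hβm : β m = s)
    (hβmono : ∀ i j, i < j → j ≤ m → β i < β j)
    (hβmem : ∀ n, (n ≤ s ∧ ∀ k, 1 ≤ k → k ≤ l - 1 → n ≠ α k) ↔ ∃ i ≤ m, β i = n)
    (A : ℕ → Finset ℕ)
    (v : Fin (s + 1) ⊕ Fin t → ℤ)
    (hv : (∃ k < t, v = cmNu s t σ β A k) ∨
          (∃ k, 1 ≤ k ∧ k ≤ m - 1 ∧ v = cmMu s t β k)) :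
    (∀ j, v j = 0 ∨ v j = 1 ∨ v j = -1) ∧
    ∃ j0, ∀ z ∈ cmLattice s t l σ α, (∀ j, z j = 0 ∨ z j = v j) → z j0 = 0 → z = 0 := by
  have hs : 0 < s := by have := hαm 0 l (by omega) le_rfl; omega
  have hm : 1 ≤ m := by
    by_contra h
    have : m = 0 := by omega
    subst this; omega
  have hM : ∀ k, k < m → ∀ n, β k < n → n < β (k + 1) →
      ∃ j, 1 ≤ j ∧ j ≤ l - 1 ∧ n = α j := by
    intro k hk n h1 h2
    by_contra hcon
    push Not at hcon
    have hle : β (k + 1) ≤ s := by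
      rcases Nat.eq_or_lt_of_le (show k + 1 ≤ m by omega) with h | h
      · rw [h, hβm]
      · rw [← hβm]; exact (hβmono _ _ h le_rfl).le
    obtain ⟨i, hi, rfl⟩ := (hβmem n).1 ⟨by omega, hcon⟩
    have a1 : k < i := by
      by_contra hh
      rcases Nat.eq_or_lt_of_le (show i ≤ k by omega) with h | h
      · subst h; omega
      · have := hβmono _ _ h (by omega); omega
    rcases Nat.eq_or_lt_of_le (show k + 1 ≤ i by omega) with h | h
    · subst h; omega
    · have := hβmono _ _ h (by omega); omega
  have hβs : ∀ k, k ≤ m → β k ≤ s := by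
    intro k hk
    rcases Nat.eq_or_lt_of_le hk with h | h
    · rw [h, hβm]
    · rw [← hβm]; exact (hβmono _ _ h le_rfl).le
  rcases hv with ⟨k, hk, rfl⟩ | ⟨k, hk1, hk2, rfl⟩
  · refine ⟨?_, Sum.inr ⟨k, hk⟩, ?_⟩
    · intro j
      unfold cmNu
      split_ifs <;> rcases j with j | j <;> simp only <;> (try split_ifs) <;> simp
    · intro z hz hzv hz0
      have hnn : ∀ j, 0 ≤ z j := by
        intro j
        rcases hzv j with h | h
        · omega
        · by_cases hj : j = Sum.inr ⟨k, hk⟩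
          · rw [hj, hz0]
          · rw [h]
            unfold cmNu
            rcases j with j | j
            · split_ifs <;> simp only <;> (try split_ifs) <;> simp
            · have : j.val ≠ k := fun hh => hj (by simp [← hh])
              split_ifs <;> simp only [if_neg this] <;> split_ifs <;> simp
      have h := hz 0 (by omega)
      unfold cmInner at h
      have hw : ∀ j, 0 ≤ z j * cmW s t σ α 0 j := by
        intro j
        apply mul_nonneg (hnn j)
        rcases j with j | j
        · simp only [cmW]; split_ifs <;> simp
        · simp only [cmW]; exact (hσpos _ j.2).le
      rw [Finset.sum_eq_zero_iff_of_nonneg (fun j _ => hw j)] at h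
      have he : ∀ j, z (Sum.inr j) = 0 := by
        intro j
        have := h (Sum.inr j) (Finset.mem_univ _)
        simp only [cmW] at this
        rcases mul_eq_zero.1 this with h | h
        · exact h
        · have := hσpos _ j.2; omega
      have hf0 : z (Sum.inl ⟨0, by omega⟩) = 0 := by
        have := h (Sum.inl ⟨0, by omega⟩) (Finset.mem_univ _)
        simpa [cmW] using this
      have hb1 := hβmono 0 1 (by omega) hm
      have := cm_chain hz hl hα0 hαl hαm 0 (β 1) (by omega) (hβs 1 hm)
        (by have := hM 0 (by omega); rw [hβ0] at this; exact this)
        (by intros; omega)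
        (by
          intro n hn hlt
          rcases hzv (Sum.inl ⟨n, hn⟩) with h | h
          · exact h
          · rw [h]; unfold cmNu
            split_ifs
            · simp only; rw [if_neg (by omega)]
            · rfl) hf0
      funext j
      rcases j with j | j
      · exact this j.1 j.2
      · exact he j
  · obtain ⟨k, rfl⟩ : ∃ i, k = i + 1 := ⟨k - 1, by omega⟩
    have hb := hβmono (k + 1) (k + 2) (by omega) (by omega)
    have hc := hβs (k + 2) (by omega)
    refine ⟨?_, Sum.inl ⟨β (k + 1), by omega⟩, ?_⟩
    · intro j
      rcases j with j | j <;> simp only [cmMu]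
      · split_ifs <;> simp
      · simp
    · intro z hz hzv hz0
      have := cm_chain hz hl hα0 hαl hαm (β (k + 1)) (β (k + 2)) hb hc (hM (k + 1) (by omega))
        (by
          intro n hn hlt
          rcases hzv (Sum.inl ⟨n, hn⟩) with h | h
          · exact h
          · rw [h]; simp only [cmMu]; rw [if_neg (by omega), if_neg (by omega)])
        (by
          intro n hn hlt
          rcases hzv (Sum.inl ⟨n, hn⟩) with h | h
          · exact h
          · rw [h]; simp only [cmMu]; rw [if_neg (by omega), if_neg (by omega)]) hz0
      funext j
      rcases j with j | j
      · exact this j.1 j.2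
      · rcases hzv (Sum.inr j) with h | h
        · exact h
        · rw [h]; rfl

/-- Every element of the standard basis `S = {ν_1, …, ν_t, μ_1, …, μ_{m−1}}` of a
`p/q`-changemaker lattice with `q > 1` is irreducible: if `v = x + y` with
`x, y ∈ L` and `x·y ≥ 0`, then `x = 0` or `y = 0`. -/
theorem stmt_14
    (p q : ℕ) (hp : 0 < p) (hq : 1 < q) (hpq : Nat.Coprime p q)
    (l : ℕ) (hl : 1 ≤ l)
    (a : ℕ → ℕ) (ha0 : 1 ≤ a 0) (ha : ∀ i, 1 ≤ i → i ≤ l → 2 ≤ a i)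
    (hcf : negCF (fun i => (a i : ℤ)) (l + 1) = (p : ℚ) / q)
    (s : ℕ) (hs : s = ∑ i ∈ Finset.Icc 1 l, (a i - 1))
    (α : ℕ → ℕ) (hα : ∀ k, α k = ∑ i ∈ Finset.Icc 1 k, (a i - 1))
    (t : ℕ) (ht : 1 ≤ t)
    (σ : ℕ → ℤ) (hσpos : ∀ i < t, 0 < σ i)
    (hσmono : ∀ i j, i ≤ j → j < t → σ i ≤ σ j)
    (hσcm : Changemaker t σ)
    (hσnorm : 1 + ∑ i ∈ Finset.range t, σ i ^ 2 = (a 0 : ℤ))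
    (m : ℕ) (β : ℕ → ℕ)
    (hβ0 : β 0 = 0) (hβm : β m = s)
    (hβmono : ∀ i j, i < j → j ≤ m → β i < β j)
    (hβmem : ∀ n, (n ≤ s ∧ ∀ k, 1 ≤ k → k ≤ l - 1 → n ≠ α k) ↔ ∃ i ≤ m, β i = n)
    (A : ℕ → Finset ℕ)
    (hA : ∀ k < t, σ k ≠ 1 + ∑ i ∈ Finset.range k, σ i →
      A k ⊆ Finset.range k ∧ σ k = (∑ i ∈ A k, σ i) ∧
      ∀ B ⊆ Finset.range k, σ k = (∑ i ∈ B, σ i) → B ≠ A k →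
        ∃ j ∈ A k, j ∉ B ∧ ∀ j' ∈ B, j' ∉ A k → j' < j)
    (v : Fin (s + 1) ⊕ Fin t → ℤ)
    (hv : (∃ k < t, v = cmNu s t σ β A k) ∨
          (∃ k, 1 ≤ k ∧ k ≤ m - 1 ∧ v = cmMu s t β k)) :
    ∀ x y : Fin (s + 1) ⊕ Fin t → ℤ,
      x ∈ cmLattice s t l σ α → y ∈ cmLattice s t l σ α →
      v = x + y → 0 ≤ cmInner x y → x = 0 ∨ y = 0 := by
  have hαsucc : ∀ k, α (k + 1) = α k + (a (k + 1) - 1) := by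
    intro k
    rw [hα, hα, Finset.sum_Icc_succ_top (by omega)]
  have hαm : ∀ i j, i < j → j ≤ l → α i < α j := by
    intro i j hij
    induction j with
    | zero => omega
    | succ j ih =>
      intro hj
      have h1 := hαsucc j
      have h2 := ha (j + 1) (by omega) hj
      rcases Nat.eq_or_lt_of_le (show i ≤ j by omega) with h | h
      · subst h; omega
      · have := ih h (by omega); omega
  obtain ⟨hv1, j0, hkey⟩ := cm_key l hl s t σ α β (by rw [hα]; simp) (by rw [hα, hs]) hαm hσpos m
    hβ0 hβm hβmono hβmem A v hv
  intro x y hx hy hxy hpos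
  have hvj : ∀ j, v j = x j + y j := fun j => by rw [hxy]; rfl
  have hle : ∀ j, x j * y j ≤ 0 := by
    intro j
    by_contra hcon
    push Not at hcon
    have h1 := hvj j
    rcases pos_and_pos_or_neg_and_neg_of_mul_pos hcon with ⟨h, h'⟩ | ⟨h, h'⟩ <;>
      rcases hv1 j with h2 | h2 | h2 <;> omega
  have hz : ∀ j, x j = 0 ∨ y j = 0 := by
    have h0 : ∑ j, x j * y j = 0 :=
      le_antisymm (Finset.sum_nonpos fun j _ => hle j) hpos
    rw [Finset.sum_eq_zero_iff_of_nonpos (fun j _ => hle j)] at h0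
    intro j
    exact mul_eq_zero.1 (h0 j (Finset.mem_univ _))
  rcases hz j0 with h | h
  · left
    refine hkey x hx (fun j => ?_) h
    have := hvj j
    rcases hz j with h | h <;> omega
  · right
    refine hkey y hy (fun j => ?_) h
    have := hvj j
    rcases hz j with h | h <;> omega
end
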